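/- arXiv:2003.04281 — 2 statements merged into one kernel-verified Lean document; each statement's English description precedes it below -/
import Mathlib

section
/- (gl₂ orthogonal SoV bases.) Let K be a 2×2 complex matrix with K ≠ x·Id for every x ∈ ℂ. Under the conditions ensuring that the covectors ⟨h| = ⟨0|∏_{a=1}^N (T^{(K)}(ξ_a)/a(ξ_a))^{h_a}, h ∈ {0,1}^N, form a basis of H* (i.e. for almost any ⟨0| and generic inhomogeneities), define |1⟩ as the unique vector with ⟨h|1⟩ = ∏_n δ_{h_n,1} / ( V(ξ₁,…,ξ_N)·V(ξ₁^{(1)},…,ξ_N^{(1)}) ). Then the vectors |h⟩ = ∏_{a=1}^N (T^{(K)}(ξ_a−η)/a(ξ_a))^{1−h_a}|1⟩, h ∈ {0,1}^N, form a basis of H orthogonal to the covector basis: ⟨h|k⟩ = ∏_n δ_{h_n,k_n} / ( V(ξ₁,…,ξ_N)·V(ξ₁^{(h₁)},…,ξ_N^{(h_N)}) ). Moreover, for any eigenvalue function t(λ) of T^{(K)}(λ), the unique eigenvector |t⟩ and eigencovector ⟨t|, normalized by ⟨0…0|t⟩ = ⟨t|1⟩ = 1/V(ξ₁,…,ξ_N),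 admit the SoV representations |t⟩ = Σ_{h∈{0,1}^N} ∏_a (t(ξ_a)/a(ξ_a))^{h_a} · V(ξ₁^{(h₁)},…,ξ_N^{(h_N)}) |h⟩ and ⟨t| = Σ_h ∏_a (t(ξ_a−η)/a(ξ_a))^{1−h_a} · V(ξ₁^{(h₁)},…,ξ_N^{(h_N)}) ⟨h|. -/
open scoped BigOperators

namespace SoVgl2

noncomputable section

/-- Basis labels of the gl₂ chain: `H = (ℂ²)^{⊗N}`. -/
abbrev St2 (N : ℕ) := Fin N → Fin 2
abbrev Hsp2 (N : ℕ) := St2 N → ℂ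
abbrev Op2 (N : ℕ) := Matrix (St2 N) (St2 N) ℂ

variable {N : ℕ}

/-- ξᵢ − ξⱼ ∉ {0, η, −η} for i ≠ j. -/
def InhomCond (η : ℂ) (ξ : Fin N → ℂ) : Prop :=
  ∀ i j : Fin N, i ≠ j → ξ i - ξ j ≠ 0 ∧ ξ i - ξ j ≠ η ∧ ξ i - ξ j ≠ -η

/-- Vandermonde product `V(x₁,…,x_M) = ∏_{i<j} (x_j − x_i)`. -/
def Vdm {M : ℕ} (x : Fin M → ℂ) : ℂ :=
  ∏ j : Fin M, ∏ i ∈ Finset.univ.filter (fun i => i < j), (x j - x i)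

/-- `a(λ) = ∏_b (λ − ξ_b + η)`. -/
def afun (η : ℂ) (ξ : Fin N → ℂ) (lam : ℂ) : ℂ := ∏ b, (lam - ξ b + η)

/-- `d(λ) = ∏_b (λ − ξ_b)`. -/
def dfun (ξ : Fin N → ℂ) (lam : ℂ) : ℂ := ∏ b, (lam - ξ b)

/-- The rational gl₂ R-matrix `R_{a,n}(λ−ξ_n)` acting on the auxiliary space and site `n`. -/
def Raux2 (η : ℂ) (ξ : Fin N → ℂ) (lam : ℂ) (n : Fin N) :
    Matrix (Fin 2 × St2 N) (Fin 2 × St2 N) ℂ := Matrix.of fun p q =>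
  (lam - ξ n) * (if p = q then 1 else 0) +
    η * (if p.1 = q.2 n ∧ p.2 = Function.update q.2 n q.1 then 1 else 0)

/-- The twist matrix `K` acting on the auxiliary space. -/
def Kaux2 (K : Matrix (Fin 2) (Fin 2) ℂ) :
    Matrix (Fin 2 × St2 N) (Fin 2 × St2 N) ℂ := Matrix.of fun p q =>
  K p.1 q.1 * (if p.2 = q.2 then 1 else 0)

/-- The gl₂ transfer matrix `T^{(K)}(λ) = tr_a [K_a R_{a,N}(λ−ξ_N)⋯R_{a,1}(λ−ξ_1)]`. -/
def Tgl2 (η : ℂ) (ξ : Fin N → ℂ) (K : Matrix (Fin 2) (Fin 2) ℂ) (lam : ℂ) : Op2 N :=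
  Matrix.of fun f g => ∑ v : Fin 2,
    ((Kaux2 K * (List.ofFn fun n : Fin N => Raux2 η ξ lam n).reverse.prod :
      Matrix (Fin 2 × St2 N) (Fin 2 × St2 N) ℂ)) (v, f) (v, g)

/-- The gl₂ SoV co-vector `⟨h| = ⟨0| ∏_a (T^{(K)}(ξ_a)/a(ξ_a))^{h_a}`. -/
def cov2 (η : ℂ) (ξ : Fin N → ℂ) (K : Matrix (Fin 2) (Fin 2) ℂ) (L0 : Hsp2 N)
    (h : St2 N) : Hsp2 N :=
  Matrix.vecMul L0
    ((List.ofFn fun a : Fin N => ((afun η ξ (ξ a))⁻¹ • Tgl2 η ξ K (ξ a)) ^ (h a : ℕ)).prod)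

/-- The gl₂ SoV vector `|h⟩ = ∏_a (T^{(K)}(ξ_a−η)/a(ξ_a))^{1−h_a} |1⟩`. -/
def vec2 (η : ℂ) (ξ : Fin N → ℂ) (K : Matrix (Fin 2) (Fin 2) ℂ) (R1 : Hsp2 N)
    (h : St2 N) : Hsp2 N :=
  Matrix.mulVec
    ((List.ofFn fun a : Fin N =>
      ((afun η ξ (ξ a))⁻¹ • Tgl2 η ξ K (ξ a - η)) ^ (1 - (h a : ℕ))).prod) R1

/-- Pairing between a co-vector and a vector. -/
def pair2 (L v : Hsp2 N) : ℂ := ∑ f, L f * v f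

/-- The label `(1,…,1)`. -/
def oneSt2 : St2 N := fun _ => 1

/-- The label `(0,…,0)`. -/
def zeroSt2 : St2 N := fun _ => 0

/-- A family of `2^N` (co-)vectors is a basis of `H`. -/
def IsBasisFamily2 (v : St2 N → Hsp2 N) : Prop :=
  LinearIndependent ℂ v ∧ Submodule.span ℂ (Set.range v) = ⊤

/-- `R1` is the reference vector `|1⟩`, uniquely characterized by
`⟨h|1⟩ = ∏_n δ_{h_n,1} / (V(ξ)·V(ξ^{(1)}))`. -/
def DualRef1 (η : ℂ) (ξ : Fin N → ℂ) (K : Matrix (Fin 2) (Fin 2) ℂ)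
    (L0 R1 : Hsp2 N) : Prop :=
  ∀ h : St2 N, pair2 (cov2 η ξ K L0 h) R1 =
    (if h = oneSt2 then 1 else 0) / (Vdm ξ * Vdm fun a => ξ a - η)

end
end SoVgl2

namespace SoVgl2
noncomputable section

section TwoAuxiliarySpaces

variable {A : Type*} [Ring A]

/-- Operators on two auxiliary spaces with entries in `A`. -/
abbrev TwoAux (A : Type*) := Matrix (Fin 2) (Fin 2) (Matrix (Fin 2) (Fin 2) A)

/-- Action on the first auxiliary space. -/
def aux1 : Matrix (Fin 2) (Fin 2) A →+* TwoAux A := (Matrix.scalar (Fin 2)).mapMatrix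

/-- Action on the second auxiliary space. -/
def aux2 : Matrix (Fin 2) (Fin 2) A →+* TwoAux A := Matrix.scalar (Fin 2)

/-- The permutation of the two auxiliary spaces. -/
def auxSwap : TwoAux A :=
  Matrix.of fun i j => Matrix.of fun k l => if i = l ∧ k = j then 1 else 0

/-- The trace over both auxiliary spaces. -/
def auxTrace (X : TwoAux A) : A := ∑ i, ∑ k, X i i k k

/-- All entries of `X` commute with all entries of `Y`. -/
def EntriesCommute (X Y : Matrix (Fin 2) (Fin 2) A) : Prop :=
  ∀ i j k l, Commute (X i j) (Y k l)

lemma aux1_mul_aux2_apply (X Y : Matrix (Fin 2) (Fin 2) A) (i j k l : Fin 2) :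
    (aux1 X * aux2 Y) i j k l = X i j * Y k l := by
  simp [aux1, aux2, Matrix.scalar_apply]

lemma aux2_mul_aux1_apply (X Y : Matrix (Fin 2) (Fin 2) A) (i j k l : Fin 2) :
    (aux2 Y * aux1 X) i j k l = Y k l * X i j := by
  simp [aux1, aux2, Matrix.scalar_apply]

lemma auxSwap_mul_apply (X : TwoAux A) (i j k l : Fin 2) :
    (auxSwap * X : TwoAux A) i j k l = X k j i l := by
  simp only [Matrix.mul_apply, Matrix.sum_apply, auxSwap, Matrix.of_apply]
  fin_cases i <;> fin_cases k <;> simp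

lemma mul_auxSwap_apply (X : TwoAux A) (i j k l : Fin 2) :
    (X * auxSwap : TwoAux A) i j k l = X i l k j := by
  simp only [Matrix.mul_apply, Matrix.sum_apply, auxSwap, Matrix.of_apply]
  fin_cases j <;> fin_cases l <;> simp

lemma auxSwap_mul_self : (auxSwap : TwoAux A) * auxSwap = 1 := by
  ext i j k l
  rw [auxSwap_mul_apply]
  simp only [auxSwap, Matrix.one_apply, Matrix.of_apply]
  fin_cases i <;> fin_cases j <;> fin_cases k <;> fin_cases l <;> simp

lemma EntriesCommute.commute_aux {X Y : Matrix (Fin 2) (Fin 2) A} (h : EntriesCommute X Y) :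
    Commute (aux1 X) (aux2 Y) := by
  ext i j k l
  rw [aux1_mul_aux2_apply, aux2_mul_aux1_apply, (h i j k l).eq]

lemma aux1_mul_aux2_mul {X Y X' Y' : Matrix (Fin 2) (Fin 2) A} (hc : EntriesCommute X' Y) :
    aux1 (X * X') * aux2 (Y * Y') = aux1 X * aux2 Y * (aux1 X' * aux2 Y') := by
  rw [map_mul, map_mul, mul_assoc, ← mul_assoc (aux1 X'), hc.commute_aux.eq]
  simp only [mul_assoc]

lemma EntriesCommute.one_right (X : Matrix (Fin 2) (Fin 2) A) : EntriesCommute X 1 := by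
  intro i j k l
  rw [Matrix.one_apply]
  split_ifs
  exacts [Commute.one_right _, Commute.zero_right _]

lemma EntriesCommute.mul_right {X Y Z : Matrix (Fin 2) (Fin 2) A} (hY : EntriesCommute X Y)
    (hZ : EntriesCommute X Z) : EntriesCommute X (Y * Z) := by
  intro i j k l
  rw [Matrix.mul_apply]
  exact Commute.sum_right _ _ _ fun m _ => (hY i j k m).mul_right (hZ i j m l)

lemma EntriesCommute.symm {X Y : Matrix (Fin 2) (Fin 2) A} (h : EntriesCommute X Y) :
    EntriesCommute Y X := fun i j k l => (h k l i j).symm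

lemma EntriesCommute.list_prod_right {X : Matrix (Fin 2) (Fin 2) A}
    {l : List (Matrix (Fin 2) (Fin 2) A)} (h : ∀ Y ∈ l, EntriesCommute X Y) :
    EntriesCommute X l.prod := by
  induction l with
  | nil => exact EntriesCommute.one_right X
  | cons Y l ih =>
    rw [List.prod_cons]
    exact (h Y (by simp)).mul_right (ih fun Z hZ => h Z (by simp [hZ]))

lemma auxTrace_add (X Y : TwoAux A) : auxTrace (X + Y) = auxTrace X + auxTrace Y := by
  simp [auxTrace, Finset.sum_add_distrib]

lemma auxTrace_swap_mul (X : TwoAux A) : auxTrace (auxSwap * X) = auxTrace (X * auxSwap) := by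
  simp only [auxTrace, auxSwap_mul_apply, mul_auxSwap_apply]
  exact Finset.sum_comm

lemma auxTrace_aux1_mul_aux2 (X Y : Matrix (Fin 2) (Fin 2) A) :
    auxTrace (aux1 X * aux2 Y) = X.trace * Y.trace := by
  simp only [auxTrace, aux1_mul_aux2_apply, Matrix.trace, Finset.sum_mul_sum, Matrix.diag_apply]

lemma auxTrace_aux2_mul_aux1 (X Y : Matrix (Fin 2) (Fin 2) A) :
    auxTrace (aux2 Y * aux1 X) = Y.trace * X.trace := by
  simp only [auxTrace, aux2_mul_aux1_apply, Matrix.trace, Finset.sum_mul_sum, Matrix.diag_apply]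
  exact Finset.sum_comm

variable [Algebra ℂ A]

lemma auxTrace_smul (c : ℂ) (X : TwoAux A) : auxTrace (c • X) = c • auxTrace X := by
  simp [auxTrace]

/-- The R-matrix `u + η P` on the two auxiliary spaces. -/
def auxR (η u : ℂ) : TwoAux A := u • 1 + η • auxSwap

lemma auxR_neg_mul (η u : ℂ) : (auxR η (-u) : TwoAux A) * auxR η u = (η ^ 2 - u ^ 2) • 1 := by
  simp only [auxR, add_mul, mul_add, smul_mul_smul_comm, auxSwap_mul_self, one_mul, mul_one]
  module

lemma auxR_mul_neg (η u : ℂ) : (auxR η u : TwoAux A) * auxR η (-u) = (η ^ 2 - u ^ 2) • 1 := by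
  simpa using auxR_neg_mul (A := A) η (-u)

lemma auxTrace_auxR_mul (η u : ℂ) (X : TwoAux A) :
    auxTrace (auxR η u * X) = auxTrace (X * auxR η u) := by
  simp only [auxR, add_mul, mul_add, auxTrace_add, smul_mul_assoc, mul_smul_comm, auxTrace_smul,
    one_mul, mul_one, auxTrace_swap_mul]

/-- The relation `R₁₂(u) X₁ Y₂ = Y₂ X₁ R₁₂(u)`. -/
def RTT (η u : ℂ) (X Y : Matrix (Fin 2) (Fin 2) A) : Prop :=
  auxR η u * (aux1 X * aux2 Y) = aux2 Y * aux1 X * auxR η u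

lemma RTT.mul {η u : ℂ} {X Y X' Y' : Matrix (Fin 2) (Fin 2) A} (h : RTT η u X Y)
    (h' : RTT η u X' Y') (hc : EntriesCommute X' Y) (hc' : EntriesCommute X Y') :
    RTT η u (X * X') (Y * Y') := by
  unfold RTT at *
  have e2 : aux2 (Y * Y') * aux1 (X * X') = aux2 Y * aux1 X * (aux2 Y' * aux1 X') := by
    rw [map_mul, map_mul, mul_assoc, ← mul_assoc (aux2 Y'), ← hc'.commute_aux.eq]
    simp only [mul_assoc]
  rw [aux1_mul_aux2_mul hc, e2, ← mul_assoc, h, mul_assoc, h']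
  simp only [mul_assoc]

lemma RTT.one (η u : ℂ) : RTT η u (1 : Matrix (Fin 2) (Fin 2) A) 1 := by
  simp [RTT]

lemma RTT.commute_trace {η u : ℂ} {X Y : Matrix (Fin 2) (Fin 2) A} (h : RTT η u X Y)
    (hu : η ^ 2 - u ^ 2 ≠ 0) : Commute X.trace Y.trace := by
  have key : auxTrace (auxR η (-u) * (auxR η u * (aux1 X * aux2 Y))) =
      auxTrace (auxR η (-u) * (aux2 Y * aux1 X * auxR η u)) := congrArg _ (congrArg _ h)
  rw [← mul_assoc, auxR_neg_mul, auxTrace_auxR_mul, mul_assoc, auxR_mul_neg, smul_mul_assoc,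
    mul_smul_comm, one_mul, mul_one, auxTrace_smul, auxTrace_smul, auxTrace_aux1_mul_aux2,
    auxTrace_aux2_mul_aux1] at key
  exact smul_right_injective A hu key

/-- `X₁ Y₂` acts as the scalar `s` on the antisymmetric part of the auxiliary spaces. -/
def ActsOnAntisymm (s : ℂ) (X Y : Matrix (Fin 2) (Fin 2) A) : Prop :=
  aux1 X * aux2 Y * (1 - auxSwap) = s • (1 - auxSwap)

lemma ActsOnAntisymm.mul {s s' : ℂ} {X Y X' Y' : Matrix (Fin 2) (Fin 2) A}
    (h : ActsOnAntisymm s X Y) (h' : ActsOnAntisymm s' X' Y') (hc : EntriesCommute X' Y) :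
    ActsOnAntisymm (s * s') (X * X') (Y * Y') := by
  unfold ActsOnAntisymm at *
  rw [aux1_mul_aux2_mul hc, mul_assoc, h', mul_smul_comm, h, smul_smul, mul_comm s']

lemma ActsOnAntisymm.one : ActsOnAntisymm 1 (1 : Matrix (Fin 2) (Fin 2) A) 1 := by
  simp [ActsOnAntisymm]

lemma trace_mul_trace_of_antisymm {s : ℂ} {X Y : Matrix (Fin 2) (Fin 2) A}
    (h : ActsOnAntisymm s X Y) (h0 : (1 + auxSwap) * (aux1 X * aux2 Y) = 0) :
    X.trace * Y.trace = s • 1 := by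
  have e1 := congrArg auxTrace h
  have e2 := congrArg auxTrace h0
  have e3 : auxTrace ((1 : TwoAux A) - auxSwap) = (2 : ℂ) • 1 := by
    simp [auxTrace, auxSwap, Fin.sum_univ_two, two_smul, -Finset.sum_boole]
  have e4 : auxTrace (0 : TwoAux A) = 0 := by simp [auxTrace]
  rw [auxTrace_smul, e3, mul_sub, mul_one, sub_eq_add_neg, ← neg_one_smul ℂ, auxTrace_add,
    auxTrace_smul] at e1
  rw [add_mul, one_mul, auxTrace_add, auxTrace_swap_mul, e4] at e2
  rw [← auxTrace_aux1_mul_aux2]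
  have e5 : (2 : ℂ) • auxTrace (aux1 X * aux2 Y) = (2 : ℂ) • s • (1 : A) := by
    calc (2 : ℂ) • auxTrace (aux1 X * aux2 Y)
        = (auxTrace (aux1 X * aux2 Y) + (-1 : ℂ) • auxTrace (aux1 X * aux2 Y * auxSwap)) +
          (auxTrace (aux1 X * aux2 Y) + auxTrace (aux1 X * aux2 Y * auxSwap)) := by module
      _ = (2 : ℂ) • s • (1 : A) := by rw [e1, e2]; module
  exact smul_right_injective A two_ne_zero e5

/-- The Lax matrix `x + η P` built from matrix units `e`. -/
def lax (η : ℂ) (e : Fin 2 → Fin 2 → A) (x : ℂ) : Matrix (Fin 2) (Fin 2) A :=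
  x • 1 + η • Matrix.of fun i j => e j i

lemma lax_apply (η : ℂ) (e : Fin 2 → Fin 2 → A) (x : ℂ) (i j : Fin 2) :
    lax η e x i j = (if i = j then x else 0) • 1 + η • e j i := by
  simp [lax, Matrix.one_apply]

/-- `e` is a system of matrix units. -/
structure IsMatrixUnits (e : Fin 2 → Fin 2 → A) : Prop where
  mul : ∀ i j k l, e i j * e k l = if j = k then e i l else 0
  sum : e 0 0 + e 1 1 = 1

lemma IsMatrixUnits.rtt {e : Fin 2 → Fin 2 → A} (he : IsMatrixUnits e) (η x y : ℂ) :
    RTT η (x - y) (lax η e x) (lax η e y) := by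
  ext i j k l
  simp only [auxR, add_mul, mul_add, smul_mul_assoc, mul_smul_comm, one_mul, mul_one,
    Matrix.add_apply, Matrix.smul_apply, auxSwap_mul_apply, mul_auxSwap_apply,
    aux1_mul_aux2_apply, aux2_mul_aux1_apply, lax_apply, he.mul]
  simp only [eq_comm (a := k) (b := l)]
  split_ifs <;> module

lemma IsMatrixUnits.actsOnAntisymm {e : Fin 2 → Fin 2 → A} (he : IsMatrixUnits e) (η x : ℂ) :
    ActsOnAntisymm ((x + η) * (x - η)) (lax η e x) (lax η e (x - η)) := by
  have h1 : e 1 1 = 1 - e 0 0 := by rw [← he.sum]; abel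
  ext i j k l
  simp only [mul_sub, mul_one, Matrix.sub_apply, Matrix.smul_apply, mul_auxSwap_apply,
    aux1_mul_aux2_apply, lax_apply, add_mul, mul_add, smul_mul_assoc, mul_smul_comm, one_mul,
    he.mul]
  simp only [auxSwap, Matrix.one_apply, Matrix.of_apply]
  fin_cases i <;> fin_cases j <;> fin_cases k <;> fin_cases l <;> simp [h1] <;> module

lemma IsMatrixUnits.symm_mul_lax {e : Fin 2 → Fin 2 → A} (he : IsMatrixUnits e) (η : ℂ) :
    (1 + auxSwap) * (aux1 (lax η e 0) * aux2 (lax η e (-η))) = 0 := by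
  ext i j k l
  simp only [add_mul, mul_add, smul_mul_assoc, mul_smul_comm, one_mul, mul_one,
    Matrix.add_apply, auxSwap_mul_apply,
    aux1_mul_aux2_apply, lax_apply, he.mul, Matrix.zero_apply]
  split_ifs <;> simp_all

/-- `X₁ Y₂` maps into the antisymmetric part of the auxiliary spaces. -/
def MapsToAntisymm (X Y : Matrix (Fin 2) (Fin 2) A) : Prop :=
  (1 + auxSwap) * (aux1 X * aux2 Y) = 0

omit [Algebra ℂ A] in
lemma MapsToAntisymm.mul {X Y X' Y' : Matrix (Fin 2) (Fin 2) A}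
    (h : MapsToAntisymm X Y) (hc : EntriesCommute X' Y) : MapsToAntisymm (X * X') (Y * Y') := by
  unfold MapsToAntisymm at *
  rw [aux1_mul_aux2_mul hc, ← mul_assoc, h, zero_mul]

lemma RTT.mul_mapsToAntisymm {η : ℂ} (hη : η ≠ 0) {X Y X' Y' : Matrix (Fin 2) (Fin 2) A}
    (h : RTT η η X Y) (h' : MapsToAntisymm X' Y') (hc : EntriesCommute X' Y) :
    MapsToAntisymm (X * X') (Y * Y') := by
  unfold RTT MapsToAntisymm at *
  have hR : (auxR η η : TwoAux A) = η • (1 + auxSwap) := by simp [auxR]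
  rw [hR, smul_mul_assoc, mul_smul_comm] at h
  have h2 : (1 + auxSwap) * (aux1 X * aux2 Y) = aux2 Y * aux1 X * (1 + auxSwap) :=
    smul_right_injective _ hη h
  rw [aux1_mul_aux2_mul hc, ← mul_assoc, h2, mul_assoc, h', mul_zero]

lemma EntriesCommute.algebraMap_left (K : Matrix (Fin 2) (Fin 2) ℂ)
    (X : Matrix (Fin 2) (Fin 2) A) : EntriesCommute (K.map (algebraMap ℂ A)) X :=
  fun _ _ _ _ => Algebra.commutes _ _

lemma RTT.algebraMap (η u : ℂ) (K : Matrix (Fin 2) (Fin 2) ℂ) :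
    RTT η u (K.map (algebraMap ℂ A)) (K.map (algebraMap ℂ A)) := by
  ext i j k l
  simp only [auxR, add_mul, mul_add, smul_mul_assoc, mul_smul_comm, one_mul, mul_one,
    Matrix.add_apply, Matrix.smul_apply, auxSwap_mul_apply, mul_auxSwap_apply,
    aux1_mul_aux2_apply, aux2_mul_aux1_apply, Matrix.map_apply, ← map_mul]
  simp only [mul_comm]

lemma ActsOnAntisymm.algebraMap (K : Matrix (Fin 2) (Fin 2) ℂ) :
    ActsOnAntisymm K.det (K.map (algebraMap ℂ A)) (K.map (algebraMap ℂ A)) := by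
  ext i j k l
  simp only [mul_sub, mul_one, Matrix.sub_apply, Matrix.smul_apply, mul_auxSwap_apply,
    aux1_mul_aux2_apply, Matrix.map_apply, ← map_mul, ← map_sub]
  simp only [auxSwap, Matrix.one_apply, Matrix.of_apply, Matrix.det_fin_two]
  fin_cases i <;> fin_cases j <;> fin_cases k <;> fin_cases l <;>
    simp [Algebra.algebraMap_eq_smul_one, mul_comm] <;> module

section Monodromy

variable {ι : Type*} (η : ℂ) (ξ : ι → ℂ) (e : ι → Fin 2 → Fin 2 → A)

/-- The untwisted monodromy matrix of a list of sites. -/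
def monodromy (l : List ι) (x : ℂ) : Matrix (Fin 2) (Fin 2) A :=
  (l.map fun n => lax η (e n) (x - ξ n)).prod

variable {e}

lemma entriesCommute_lax {n m : ι} (h : ∀ i j k l, Commute (e n i j) (e m k l)) (x y : ℂ) :
    EntriesCommute (lax η (e n) x) (lax η (e m) y) := by
  intro i j k l
  simp only [lax_apply]
  exact ((Commute.one_left _).smul_left _).add_left
    ((((Commute.one_right _).smul_right _).add_right ((h _ _ _ _).smul_right _)).smul_left _)

variable (he : ∀ n, IsMatrixUnits (e n))
  (hcomm : ∀ n m, n ≠ m → ∀ i j k l, Commute (e n i j) (e m k l))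

include hcomm in
lemma entriesCommute_monodromy {n : ι} {l : List ι} (hn : n ∉ l) (x y : ℂ) :
    EntriesCommute (lax η (e n) x) (monodromy η ξ e l y) := by
  refine EntriesCommute.list_prod_right fun Y hY => ?_
  obtain ⟨m, hm, rfl⟩ := List.mem_map.1 hY
  exact entriesCommute_lax η (hcomm n m fun h => hn (h ▸ hm)) _ _

include he hcomm

lemma rtt_monodromy {l : List ι} (hl : l.Nodup) (x y : ℂ) :
    RTT η (x - y) (monodromy η ξ e l x) (monodromy η ξ e l y) := by
  induction l with
  | nil => exact RTT.one η _
  | cons n l ih =>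
    rw [List.nodup_cons] at hl
    have h := (he n).rtt η (x - ξ n) (y - ξ n)
    rw [sub_sub_sub_cancel_right] at h
    exact h.mul (ih hl.2) (entriesCommute_monodromy η ξ hcomm hl.1 _ _).symm
      (entriesCommute_monodromy η ξ hcomm hl.1 _ _)

lemma actsOnAntisymm_monodromy {l : List ι} (hl : l.Nodup) (x : ℂ) :
    ∃ s, ActsOnAntisymm s (monodromy η ξ e l x) (monodromy η ξ e l (x - η)) := by
  induction l with
  | nil => exact ⟨1, ActsOnAntisymm.one⟩
  | cons n l ih =>
    rw [List.nodup_cons] at hl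
    obtain ⟨s, hs⟩ := ih hl.2
    have h := (he n).actsOnAntisymm η (x - ξ n)
    rw [sub_right_comm] at h
    exact ⟨_, h.mul hs (entriesCommute_monodromy η ξ hcomm hl.1 _ _).symm⟩

lemma mapsToAntisymm_monodromy (hη : η ≠ 0) {l : List ι} (hl : l.Nodup) {a : ι} (ha : a ∈ l) :
    MapsToAntisymm (monodromy η ξ e l (ξ a)) (monodromy η ξ e l (ξ a - η)) := by
  induction l with
  | nil => simp at ha
  | cons n l ih =>
    rw [List.nodup_cons] at hl
    have hc := (entriesCommute_monodromy η ξ hcomm hl.1 (ξ a - η - ξ n) (ξ a)).symm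
    rcases List.mem_cons.1 ha with rfl | ha
    · have h : MapsToAntisymm (lax η (e a) (ξ a - ξ a)) (lax η (e a) (ξ a - η - ξ a)) := by
        rw [sub_self, sub_right_comm, sub_self, zero_sub]
        exact (he a).symm_mul_lax η
      exact h.mul hc
    · have h := (he n).rtt η (ξ a - ξ n) (ξ a - η - ξ n)
      rw [sub_sub_sub_cancel_right, sub_sub_cancel] at h
      exact h.mul_mapsToAntisymm hη (ih hl.2 ha) hc

lemma commute_trace_twisted_monodromy {l : List ι} (hl : l.Nodup)
    (K : Matrix (Fin 2) (Fin 2) ℂ) {x y : ℂ} (hxy : η ^ 2 - (x - y) ^ 2 ≠ 0) :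
    Commute (K.map (algebraMap ℂ A) * monodromy η ξ e l x).trace
      (K.map (algebraMap ℂ A) * monodromy η ξ e l y).trace :=
  ((RTT.algebraMap η (x - y) K).mul (rtt_monodromy η ξ he hcomm hl x y)
    (EntriesCommute.algebraMap_left K _).symm
    (EntriesCommute.algebraMap_left K _)).commute_trace hxy

lemma trace_twisted_monodromy_fusion (hη : η ≠ 0) {l : List ι} (hl : l.Nodup)
    (K : Matrix (Fin 2) (Fin 2) ℂ) {a : ι} (ha : a ∈ l) :
    ∃ q : ℂ, (K.map (algebraMap ℂ A) * monodromy η ξ e l (ξ a)).trace *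
      (K.map (algebraMap ℂ A) * monodromy η ξ e l (ξ a - η)).trace = q • 1 := by
  obtain ⟨s, hs⟩ := actsOnAntisymm_monodromy η ξ he hcomm hl (ξ a)
  exact ⟨_, trace_mul_trace_of_antisymm
    ((ActsOnAntisymm.algebraMap K).mul hs (EntriesCommute.algebraMap_left K _).symm)
    ((RTT.algebraMap η η K).mul_mapsToAntisymm hη
      (mapsToAntisymm_monodromy η ξ he hcomm hη hl ha)
      (EntriesCommute.algebraMap_left K _).symm)⟩

end Monodromy

end TwoAuxiliarySpaces

section Chain

variable {N : ℕ}

/-- The matrix unit `E_{ij}` acting at site `n`. -/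
def siteUnit (n : Fin N) (i j : Fin 2) : Op2 N :=
  Matrix.of fun f g => if g n = j ∧ f = Function.update g n i then 1 else 0

lemma mul_siteUnit_apply (X : Op2 N) (n : Fin N) (i j : Fin 2) (f g : St2 N) :
    (X * siteUnit n i j) f g = if g n = j then X f (Function.update g n i) else 0 := by
  rw [Matrix.mul_apply]
  split_ifs with h <;> simp [siteUnit, h]

lemma isMatrixUnits_siteUnit (n : Fin N) : IsMatrixUnits (siteUnit n) where
  mul i j k l := by
    ext f g
    rw [mul_siteUnit_apply]
    by_cases h : j = k <;> by_cases h' : g n = l <;>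
      simp [siteUnit, h, h', eq_comm (a := k)]
  sum := by
    ext f g
    have hg : ∀ i, g n = i → Function.update g n i = g := by rintro _ rfl; simp
    by_cases h : g n = 0
    · simp [siteUnit, h, hg, Matrix.one_apply]
    · have h1 : g n = 1 := by omega
      simp [siteUnit, h1, hg, Matrix.one_apply]

lemma commute_siteUnit {n m : Fin N} (h : n ≠ m) (i j k l : Fin 2) :
    Commute (siteUnit n i j) (siteUnit m k l) := by
  ext f g
  rw [mul_siteUnit_apply, mul_siteUnit_apply]
  by_cases h1 : g m = l <;> by_cases h2 : g n = j <;>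
    simp [siteUnit, h1, h2, h, h.symm, Function.update_comm h]

lemma comp_lax (η : ℂ) (ξ : Fin N → ℂ) (lam : ℂ) (n : Fin N) :
    Matrix.compRingEquiv (Fin 2) (St2 N) ℂ (lax η (siteUnit n) (lam - ξ n)) =
      Raux2 η ξ lam n := by
  ext ⟨i, f⟩ ⟨j, g⟩
  have e : Matrix.compRingEquiv (Fin 2) (St2 N) ℂ (lax η (siteUnit n) (lam - ξ n)) (i, f) (j, g) =
    lax η (siteUnit n) (lam - ξ n) i j f g := rfl
  rw [e, lax_apply]
  by_cases h : i = j <;>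
    simp [Raux2, siteUnit, h, Matrix.one_apply, Prod.ext_iff, eq_comm]

lemma comp_twist (K : Matrix (Fin 2) (Fin 2) ℂ) :
    Matrix.compRingEquiv (Fin 2) (St2 N) ℂ (K.map (algebraMap ℂ (Op2 N))) = Kaux2 K := by
  ext ⟨i, f⟩ ⟨j, g⟩
  have e : Matrix.compRingEquiv (Fin 2) (St2 N) ℂ (K.map (algebraMap ℂ (Op2 N))) (i, f) (j, g) =
    algebraMap ℂ (Op2 N) (K i j) f g := rfl
  rw [e, Matrix.algebraMap_matrix_apply]
  simp [Kaux2]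

lemma Tgl2_eq_trace (η : ℂ) (ξ : Fin N → ℂ) (K : Matrix (Fin 2) (Fin 2) ℂ) (lam : ℂ) :
    Tgl2 η ξ K lam = (K.map (algebraMap ℂ (Op2 N)) *
      monodromy η ξ siteUnit (List.finRange N).reverse lam).trace := by
  have key : Matrix.compRingEquiv (Fin 2) (St2 N) ℂ (K.map (algebraMap ℂ (Op2 N)) *
      monodromy η ξ siteUnit (List.finRange N).reverse lam) =
      Kaux2 K * (List.ofFn fun n : Fin N => Raux2 η ξ lam n).reverse.prod := by
    rw [map_mul, comp_twist, monodromy, map_list_prod, List.map_map, List.map_reverse,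
      List.ofFn_eq_map]
    congr 3
    exact List.map_congr_left fun n _ => comp_lax η ξ lam n
  ext f g
  rw [Tgl2, ← key, Matrix.trace, Matrix.sum_apply]
  rfl

lemma commute_Tgl2_of_ne (η : ℂ) (ξ : Fin N → ℂ) (K : Matrix (Fin 2) (Fin 2) ℂ) {x y : ℂ}
    (hxy : η ^ 2 - (x - y) ^ 2 ≠ 0) : Commute (Tgl2 η ξ K x) (Tgl2 η ξ K y) := by
  rw [Tgl2_eq_trace, Tgl2_eq_trace]
  exact commute_trace_twisted_monodromy η ξ isMatrixUnits_siteUnit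
    (fun _ _ h => commute_siteUnit h) (List.nodup_reverse.2 (List.nodup_finRange N)) K hxy

lemma Tgl2_fusion {η : ℂ} (hη : η ≠ 0) (ξ : Fin N → ℂ) (K : Matrix (Fin 2) (Fin 2) ℂ)
    (a : Fin N) : ∃ q : ℂ, Tgl2 η ξ K (ξ a) * Tgl2 η ξ K (ξ a - η) = q • 1 := by
  rw [Tgl2_eq_trace, Tgl2_eq_trace]
  exact trace_twisted_monodromy_fusion η ξ isMatrixUnits_siteUnit
    (fun _ _ h => commute_siteUnit h) hη (List.nodup_reverse.2 (List.nodup_finRange N)) K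
    (by simp)

open Polynomial in
lemma exists_polynomial_list_prod {ι : Type*} [Fintype ι] [DecidableEq ι]
    (l : List (Matrix ι ι ℂ)) : ∃ Q : Matrix ι ι ℂ[X],
      (∀ (x : ℂ) p q, (Q p q).eval x = (l.map fun B => x • (1 : Matrix ι ι ℂ) + B).prod p q) ∧
      ∀ p q, Q p q - (if p = q then X ^ l.length else 0) ∈ degreeLT ℂ l.length := by
  induction l with
  | nil =>
    refine ⟨1, fun x p q => ?_, fun p q => ?_⟩
    · by_cases h : p = q <;> simp [h, Matrix.one_apply]
    · by_cases h : p = q <;> simp [h, Matrix.one_apply]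
  | cons B l ih =>
    obtain ⟨Q, hQ, hdeg⟩ := ih
    have hmem : ∀ p q, Q p q ∈ degreeLT ℂ (l.length + 1) := fun p q => by
      rw [← sub_add_cancel (Q p q) (if p = q then X ^ l.length else 0)]
      refine add_mem (degreeLT_mono (Nat.le_succ _) (hdeg p q)) ?_
      split_ifs
      · rw [mem_degreeLT, degree_X_pow]
        exact_mod_cast Nat.lt_succ_self _
      · exact zero_mem _
    refine ⟨Matrix.of fun p q => X * Q p q + ∑ r, C (B p r) * Q r q, fun x p q => ?_,
      fun p q => ?_⟩
    · simp only [Matrix.of_apply, eval_add, eval_mul, eval_X, eval_finsetSum, eval_C, hQ,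
        List.map_cons, List.prod_cons, add_mul, smul_mul_assoc, one_mul, Matrix.add_apply,
        Matrix.smul_apply, smul_eq_mul, Matrix.mul_apply (M := B)]
    · have e : (Matrix.of fun p q => X * Q p q + ∑ r, C (B p r) * Q r q) p q -
          (if p = q then X ^ (B :: l).length else 0) =
          X * (Q p q - if p = q then X ^ l.length else 0) + ∑ r, C (B p r) * Q r q := by
        by_cases h : p = q
        · simp [h, pow_succ']
          ring
        · simp [h]
      rw [e]
      refine add_mem ?_ (sum_mem fun r _ => ?_)
      · have h := hdeg p q
        rw [mem_degreeLT, degree_lt_iff_coeff_zero] at h ⊢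
        intro m hm
        obtain ⟨m, rfl⟩ := Nat.exists_eq_add_one_of_ne_zero (Nat.ne_zero_of_lt hm)
        rw [coeff_X_mul]
        exact h m (Nat.le_of_succ_le_succ hm)
      · rw [← smul_eq_C_mul]
        exact Submodule.smul_mem _ _ (hmem r q)

lemma Raux2_eq_add (η : ℂ) (ξ : Fin N → ℂ) (lam : ℂ) (n : Fin N) :
    Raux2 η ξ lam n = lam • 1 + Raux2 η ξ 0 n := by
  ext p q
  by_cases h : p = q
  · simp [Raux2, h]
    ring
  · simp [Raux2, h]

open Polynomial in
lemma exists_polynomial_Tgl2_apply (η : ℂ) (ξ : Fin N → ℂ) (K : Matrix (Fin 2) (Fin 2) ℂ)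
    (f g : St2 N) : ∃ P : ℂ[X], (∀ x, P.eval x = Tgl2 η ξ K x f g) ∧
      P - C (K.trace * (1 : Op2 N) f g) * X ^ N ∈ degreeLT ℂ N := by
  obtain ⟨Q, hQ, hdeg⟩ :=
    exists_polynomial_list_prod (List.ofFn fun n : Fin N => Raux2 η ξ 0 n).reverse
  simp only [List.length_reverse, List.length_ofFn] at hdeg
  refine ⟨∑ v, ∑ r, C (Kaux2 K (v, f) r) * Q r (v, g), fun x => ?_, ?_⟩
  · have e : (List.ofFn fun n : Fin N => Raux2 η ξ x n).reverse =
        (List.ofFn fun n : Fin N => Raux2 η ξ 0 n).reverse.map fun B => x • 1 + B := by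
      rw [List.map_reverse, List.map_ofFn]
      simp only [Function.comp_def, ← Raux2_eq_add]
    simp only [eval_finsetSum, eval_mul, eval_C, hQ, Tgl2, e, Matrix.of_apply, Matrix.mul_apply]
  · have e : C (K.trace * (1 : Op2 N) f g) * X ^ N = ∑ v, ∑ r, C (Kaux2 K (v, f) r) *
        (if r = (v, g) then X ^ N else 0) := by
      by_cases h : f = g <;> simp [h, Kaux2, Matrix.trace, Matrix.one_apply, add_mul]
    rw [e]
    simp only [← Finset.sum_sub_distrib, ← mul_sub]
    exact sum_mem fun v _ => sum_mem fun r _ => by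
      rw [← smul_eq_C_mul]
      exact Submodule.smul_mem _ _ (hdeg _ _)

open Polynomial in
lemma Tgl2_interpolation (η : ℂ) (ξ : Fin N → ℂ) (K : Matrix (Fin 2) (Fin 2) ℂ)
    {x : Fin N → ℂ} (hx : Function.Injective x) (lam : ℂ) :
    Tgl2 η ξ K lam = (K.trace * ∏ b, (lam - x b)) • 1 +
      ∑ b, (∏ c ∈ Finset.univ.erase b, (x b - x c)⁻¹ * (lam - x c)) • Tgl2 η ξ K (x b) := by
  ext f g
  obtain ⟨P, hP, hdeg⟩ := exists_polynomial_Tgl2_apply η ξ K f g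
  have hnodal : X ^ N - Lagrange.nodal Finset.univ x ∈ degreeLT ℂ N := by
    have hd : (Lagrange.nodal Finset.univ x).degree = N := by
      simp [Lagrange.degree_nodal]
    have h := degree_sub_lt_left (p := (X : ℂ[X]) ^ N) (q := Lagrange.nodal Finset.univ x)
      (by rw [hd, degree_X_pow]) (pow_ne_zero _ X_ne_zero)
      (by rw [(monic_X_pow N).leadingCoeff, Lagrange.nodal_monic.leadingCoeff])
    rwa [degree_X_pow, ← mem_degreeLT] at h
  have hmem := add_mem hdeg
    (Submodule.smul_mem _ (K.trace * (1 : Op2 N) f g) hnodal)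
  rw [smul_eq_C_mul, mul_sub, sub_add_sub_cancel, mem_degreeLT] at hmem
  have hI := congrArg (eval lam) (Lagrange.eq_interpolate (s := Finset.univ) hx.injOn
    (by simpa using hmem))
  simp only [Lagrange.interpolate_apply, eval_finsetSum, eval_mul, eval_sub, eval_C,
    Lagrange.eval_nodal_at_node (Finset.mem_univ _), Lagrange.basis, Lagrange.basisDivisor,
    eval_prod, Lagrange.eval_nodal, hP, eval_X, mul_zero, sub_zero] at hI
  simp only [Matrix.add_apply, Matrix.smul_apply, Matrix.sum_apply, smul_eq_mul]
  rw [sub_eq_iff_eq_add] at hI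
  rw [hI, add_comm]
  congr 1
  · ring
  · exact Finset.sum_congr rfl fun b _ => mul_comm _ _

section Parameters

variable {η : ℂ} {ξ : Fin N → ℂ}

/-- The shifted inhomogeneities `ξ_a - h_a η`. -/
def shifted (η : ℂ) (ξ : Fin N → ℂ) (h : St2 N) (a : Fin N) : ℂ := ξ a - ((h a : ℕ) : ℂ) * η

lemma InhomCond.shifted_injective (hξ : InhomCond η ξ) (h : St2 N) :
    Function.Injective (shifted η ξ h) := by
  intro a b hab
  by_contra hne
  obtain ⟨h0, h1, h2⟩ := hξ a b hne
  have hab' : ξ a - ξ b = (((h a : ℕ) : ℂ) - ((h b : ℕ) : ℂ)) * η := by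
    simp only [shifted] at hab
    linear_combination hab
  rcases Fin.exists_fin_two.1 ⟨h a, rfl⟩ with ha | ha <;>
    rcases Fin.exists_fin_two.1 ⟨h b, rfl⟩ with hb | hb <;>
    simp_all

lemma InhomCond.injective (hξ : InhomCond η ξ) : Function.Injective ξ := by
  have e : shifted η ξ zeroSt2 = ξ := funext fun a => by simp [shifted, zeroSt2]
  exact e ▸ hξ.shifted_injective zeroSt2

lemma InhomCond.afun_ne_zero (hη : η ≠ 0) (hξ : InhomCond η ξ) (a : Fin N) :
    afun η ξ (ξ a) ≠ 0 := by
  refine Finset.prod_ne_zero_iff.2 fun b _ h => ?_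
  rcases eq_or_ne a b with rfl | hne
  · exact hη (by simpa using h)
  · exact (hξ a b hne).2.2 (eq_neg_of_add_eq_zero_left h)

lemma Vdm_ne_zero {x : Fin N → ℂ} (hx : Function.Injective x) : Vdm x ≠ 0 :=
  Finset.prod_ne_zero_iff.2 fun _ _ => Finset.prod_ne_zero_iff.2 fun _ hi =>
    sub_ne_zero.2 (hx.ne (Finset.mem_filter.1 hi).2.ne')

lemma exists_Vdm_eq_mul (x : Fin N → ℂ) (d : Fin N) : ∃ r : ℂ, ∀ y : ℂ,
    Vdm (Function.update x d y) = r * ∏ c ∈ Finset.univ.erase d, (y - x c) := by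
  refine ⟨(∏ c ∈ Finset.univ.erase d, if c < d then 1 else -1) *
    ∏ j ∈ Finset.univ.erase d, ∏ i ∈ Finset.univ.erase d, if i < j then x j - x i else 1,
    fun y => ?_⟩
  simp only [Vdm, Finset.prod_filter]
  rw [← Finset.mul_prod_erase _ _ (Finset.mem_univ d),
    ← Finset.mul_prod_erase _ _ (Finset.mem_univ d), if_neg (lt_irrefl d), one_mul]
  have h2 : ∀ j ∈ Finset.univ.erase d,
      (∏ i, if i < j then Function.update x d y j - Function.update x d y i else 1) =
      (if d < j then x j - y else 1) *
        ∏ i ∈ Finset.univ.erase d, if i < j then x j - x i else 1 := by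
    intro j hj
    have hj := Finset.ne_of_mem_erase hj
    rw [← Finset.mul_prod_erase _ _ (Finset.mem_univ d)]
    simp only [Function.update_self, Function.update_of_ne hj]
    congr 1
    exact Finset.prod_congr rfl fun i hi => by
      rw [Function.update_of_ne (Finset.ne_of_mem_erase hi)]
  rw [Finset.prod_congr rfl h2, Finset.prod_mul_distrib, ← mul_assoc,
    mul_right_comm (∏ c ∈ Finset.univ.erase d, if c < d then (1 : ℂ) else -1)]
  congr 1
  rw [← Finset.prod_mul_distrib, ← Finset.prod_mul_distrib]
  refine Finset.prod_congr rfl fun c hc => ?_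
  have hc := Finset.ne_of_mem_erase hc
  rw [Function.update_self, Function.update_of_ne hc]
  rcases lt_or_gt_of_ne hc with h | h
  · simp [h, h.not_gt]
  · simp [h, h.not_gt]

lemma Vdm_update_mul (x : Fin N → ℂ) (d : Fin N) (y : ℂ) :
    Vdm (Function.update x d y) * ∏ c ∈ Finset.univ.erase d, (x d - x c) =
      Vdm x * ∏ c ∈ Finset.univ.erase d, (y - x c) := by
  obtain ⟨r, hr⟩ := exists_Vdm_eq_mul x d
  have h := hr (x d)
  rw [Function.update_eq_self] at h
  rw [hr, h]
  ring

lemma shifted_update_one {h : St2 N} {d : Fin N} (hd : h d = 0) :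
    shifted η ξ (Function.update h d 1) = Function.update (shifted η ξ h) d (ξ d - η) := by
  funext a
  rcases eq_or_ne a d with rfl | hne
  · simp [shifted]
  · simp [shifted, hne]

lemma commute_Tgl2 (hξ : InhomCond η ξ) (K : Matrix (Fin 2) (Fin 2) ℂ) (x y : ℂ) :
    Commute (Tgl2 η ξ K x) (Tgl2 η ξ K y) := by
  have h1 : ∀ a b, Commute (Tgl2 η ξ K (ξ a)) (Tgl2 η ξ K (ξ b)) := by
    intro a b
    rcases eq_or_ne a b with rfl | hne
    · exact Commute.refl _
    · obtain ⟨-, h1, h2⟩ := hξ a b hne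
      refine commute_Tgl2_of_ne η ξ K ?_
      rw [sq_sub_sq]
      exact mul_ne_zero (fun h => h2 (by linear_combination h))
        (fun h => h1 (by linear_combination -h))
  rw [Tgl2_interpolation η ξ K hξ.injective x, Tgl2_interpolation η ξ K hξ.injective y]
  refine Commute.add_left ((Commute.one_left _).smul_left _) (Commute.sum_left _ _ _ fun a _ => ?_)
  exact Commute.add_right ((Commute.one_right _).smul_right _)
    (Commute.sum_right _ _ _ fun b _ => ((h1 a b).smul_left _).smul_right _)

lemma list_prod_ofFn_eq_mul {M : Type*} [Monoid M] {n : ℕ} {F G : Fin n → M} {y : M} {d : Fin n}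
    (hF : ∀ b, b ≠ d → F b = G b) (hd : F d = G d * y) (hy : ∀ b, Commute y (G b)) :
    (List.ofFn F).prod = (List.ofFn G).prod * y := by
  induction n with
  | zero => exact d.elim0
  | succ n ih =>
    rw [List.ofFn_succ, List.ofFn_succ, List.prod_cons, List.prod_cons]
    induction d using Fin.cases with
    | zero =>
      have hc : Commute y (List.ofFn fun i => G (Fin.succ i)).prod :=
        Commute.list_prod_right _ _ fun z hz => by
          obtain ⟨b, rfl⟩ := List.mem_ofFn.1 hz
          exact hy _
      have e : (fun i => F (Fin.succ i)) = fun i => G (Fin.succ i) :=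
        funext fun i => hF _ (Fin.succ_ne_zero i)
      rw [hd, e, mul_assoc, hc.eq, mul_assoc]
    | succ d =>
      rw [hF 0 (Fin.succ_ne_zero d).symm, ih (fun b hb => hF _ (by simpa using hb)) hd
        (fun b => hy _), mul_assoc]

lemma pair2_vecMul (L v : Hsp2 N) (M : Op2 N) :
    pair2 (Matrix.vecMul L M) v = pair2 L (Matrix.mulVec M v) :=
  (Matrix.dotProduct_mulVec L M v).symm

lemma pair2_add_left (L L' v : Hsp2 N) : pair2 (L + L') v = pair2 L v + pair2 L' v :=
  add_dotProduct L L' v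

lemma pair2_smul_left (c : ℂ) (L v : Hsp2 N) : pair2 (c • L) v = c * pair2 L v :=
  smul_dotProduct c L v

lemma pair2_smul_right (c : ℂ) (L v : Hsp2 N) : pair2 L (c • v) = c * pair2 L v :=
  dotProduct_smul c L v

lemma pair2_sum_left {ι : Type*} (s : Finset ι) (L : ι → Hsp2 N) (v : Hsp2 N) :
    pair2 (∑ i ∈ s, L i) v = ∑ i ∈ s, pair2 (L i) v :=
  sum_dotProduct s L v

lemma pair2_sum_right {ι : Type*} (s : Finset ι) (L : Hsp2 N) (v : ι → Hsp2 N) :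
    pair2 L (∑ i ∈ s, v i) = ∑ i ∈ s, pair2 L (v i) :=
  dotProduct_sum L s v

lemma IsBasisFamily2.ext_right {c : St2 N → Hsp2 N} (hc : IsBasisFamily2 c) {v w : Hsp2 N}
    (h : ∀ k, pair2 (c k) v = pair2 (c k) w) : v = w := by
  refine dotProduct_eq v w fun u => ?_
  have hu : u ∈ Submodule.span ℂ (Set.range c) := hc.2 ▸ Submodule.mem_top
  rw [dotProduct_comm v, dotProduct_comm w]
  induction hu using Submodule.span_induction with
  | mem x hx => obtain ⟨k, rfl⟩ := hx; exact h k
  | zero => simp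
  | add x y _ _ hx hy => rw [add_dotProduct, add_dotProduct, hx, hy]
  | smul r x _ hx => rw [smul_dotProduct, smul_dotProduct, hx]

lemma IsBasisFamily2.ext_left {c : St2 N → Hsp2 N} (hc : IsBasisFamily2 c) {v w : Hsp2 N}
    (h : ∀ k, pair2 v (c k) = pair2 w (c k)) : v = w :=
  hc.ext_right fun k => (dotProduct_comm _ _).trans ((h k).trans (dotProduct_comm _ _))

lemma isBasisFamily2_of_pair2 {c v : St2 N → Hsp2 N} {w : St2 N → ℂ} (hw : ∀ h, w h ≠ 0)
    (hcv : ∀ h k, pair2 (c h) (v k) = (if h = k then 1 else 0) / w h) : IsBasisFamily2 v := by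
  have hli : LinearIndependent ℂ v := by
    rw [Fintype.linearIndependent_iff]
    intro g hg k
    have h := congrArg (pair2 (c k)) hg
    simp only [pair2_sum_right, pair2_smul_right, hcv] at h
    simpa [pair2, hw k, ite_div] using h
  exact ⟨hli, hli.span_eq_top_of_card_eq_finrank' (by simp)⟩

variable {K : Matrix (Fin 2) (Fin 2) ℂ} {L0 R1 : Hsp2 N}

lemma cov2_update_one (hξ : InhomCond η ξ) {h : St2 N} {d : Fin N} (hd : h d = 0) :
    cov2 η ξ K L0 (Function.update h d 1) =
      Matrix.vecMul (cov2 η ξ K L0 h) ((afun η ξ (ξ d))⁻¹ • Tgl2 η ξ K (ξ d)) := by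
  rw [cov2, cov2, Matrix.vecMul_vecMul]
  congr 1
  refine list_prod_ofFn_eq_mul (d := d) (fun b hb => by simp [hb]) (by simp [hd]) fun b => ?_
  exact (((commute_Tgl2 hξ K _ _).smul_left _).smul_right _).pow_right _

lemma vec2_of_eq_zero (hξ : InhomCond η ξ) {k : St2 N} {d : Fin N} (hd : k d = 0) :
    vec2 η ξ K R1 k = Matrix.mulVec ((afun η ξ (ξ d))⁻¹ • Tgl2 η ξ K (ξ d - η))
      (vec2 η ξ K R1 (Function.update k d 1)) := by
  have hc : ∀ b, Commute ((afun η ξ (ξ d))⁻¹ • Tgl2 η ξ K (ξ d - η))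
      (((afun η ξ (ξ b))⁻¹ • Tgl2 η ξ K (ξ b - η)) ^ (1 - (Function.update k d 1 b : ℕ))) :=
    fun b => (((commute_Tgl2 hξ K _ _).smul_left _).smul_right _).pow_right _
  rw [vec2, vec2, Matrix.mulVec_mulVec]
  congr 1
  rw [list_prod_ofFn_eq_mul (d := d) (fun b hb => by simp [hb]) (by simp [hd]) hc]
  refine (Commute.list_prod_right _ _ fun z hz => ?_).eq.symm
  obtain ⟨b, rfl⟩ := List.mem_ofFn.1 hz
  exact hc b

lemma vec2_one : vec2 η ξ K R1 oneSt2 = R1 := by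
  simp [vec2, oneSt2]

lemma cov2_zero : cov2 η ξ K L0 zeroSt2 = L0 := by
  simp [cov2, zeroSt2]

lemma pair2_cov2_vec2 (hη : η ≠ 0) (hξ : InhomCond η ξ) (hR1 : DualRef1 η ξ K L0 R1)
    (k h : St2 N) : pair2 (cov2 η ξ K L0 h) (vec2 η ξ K R1 k) =
      (if h = k then 1 else 0) / (Vdm ξ * Vdm (shifted η ξ h)) := by
  induction hm : (Finset.univ.filter fun a => k a = 0).card generalizing k h with
  | zero =>
    have hk : k = oneSt2 := funext fun a => by
      have := Finset.filter_eq_empty_iff.1 (Finset.card_eq_zero.1 hm) (Finset.mem_univ a)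
      exact (Fin.eq_one_of_ne_zero _ this)
    rw [hk, vec2_one, hR1 h]
    split_ifs with hh
    · have e : shifted η ξ oneSt2 = fun a => ξ a - η := funext fun a => by simp [shifted, oneSt2]
      rw [hh, e]
    · simp
  | succ m ih =>
    obtain ⟨d, hd⟩ := Finset.card_pos.1 (by rw [hm]; exact Nat.succ_pos m)
    have hkd : k d = 0 := (Finset.mem_filter.1 hd).2
    have hm' : (Finset.univ.filter fun a => Function.update k d 1 a = 0).card = m := by
      have e : (Finset.univ.filter fun a => Function.update k d 1 a = 0) =
          (Finset.univ.filter fun a => k a = 0).erase d := by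
        ext a
        rcases eq_or_ne a d with rfl | ha <;> simp [*]
      rw [e, Finset.card_erase_of_mem hd, hm, Nat.add_sub_cancel]
    have ih := fun h => ih (Function.update k d 1) h hm'
    have hzero : ∀ h : St2 N, h d = 0 →
        pair2 (cov2 η ξ K L0 h) (vec2 η ξ K R1 (Function.update k d 1)) = 0 := by
      intro h hh
      rw [ih h, if_neg, zero_div]
      rintro rfl
      simp at hh
    rw [vec2_of_eq_zero hξ hkd, Matrix.smul_mulVec, pair2_smul_right, ← pair2_vecMul]
    rcases Fin.exists_fin_two.1 ⟨h d, rfl⟩ with hhd | hhd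
    · have hone : ∀ b, pair2 (Matrix.vecMul (cov2 η ξ K L0 h) (Tgl2 η ξ K (shifted η ξ h b)))
          (vec2 η ξ K R1 (Function.update k d 1)) = if b = d then afun η ξ (ξ d) *
            pair2 (cov2 η ξ K L0 (Function.update h d 1))
              (vec2 η ξ K R1 (Function.update k d 1)) else 0 := by
        intro b
        have ha := hξ.afun_ne_zero hη b
        split_ifs with hb
        · subst hb
          rw [cov2_update_one hξ hhd, Matrix.vecMul_smul, pair2_smul_left,
            mul_inv_cancel_left₀ ha]
          simp [shifted, hhd]
        · rcases Fin.exists_fin_two.1 ⟨h b, rfl⟩ with hhb | hhb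
          · have h2 := hzero (Function.update h b 1) (by simp [Ne.symm hb, hhd])
            rw [cov2_update_one hξ hhb, Matrix.vecMul_smul, pair2_smul_left] at h2
            simpa [shifted, hhb, ha] using h2
          · obtain ⟨q, hq⟩ := Tgl2_fusion hη ξ K b
            have h2 := cov2_update_one (K := K) (L0 := L0) hξ (h := Function.update h b 0) (d := b)
              (by simp)
            rw [Function.update_idem, Function.update_eq_self_iff.2 hhb.symm] at h2
            rw [h2, Matrix.vecMul_vecMul]
            simp only [shifted, hhb, Fin.val_one, Nat.cast_one, one_mul]
            rw [smul_mul_assoc, hq, Matrix.vecMul_smul, Matrix.vecMul_smul, Matrix.vecMul_one,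
              pair2_smul_left, pair2_smul_left, hzero _ (by simp [Ne.symm hb, hhd])]
            simp
      rw [Tgl2_interpolation η ξ K (hξ.shifted_injective h) (ξ d - η), Matrix.vecMul_add,
        Matrix.vecMul_smul, Matrix.vecMul_one, Matrix.vecMul_sum, pair2_add_left, pair2_smul_left,
        hzero h hhd, mul_zero, zero_add, pair2_sum_left]
      simp only [Matrix.vecMul_smul, pair2_smul_left, hone, mul_ite, mul_zero,
        Finset.sum_ite_eq', Finset.mem_univ, if_true]
      rw [ih, shifted_update_one hhd]
      have hiff : Function.update h d 1 = Function.update k d 1 ↔ h = k := by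
        refine ⟨fun e => funext fun a => ?_, fun e => e ▸ rfl⟩
        rcases eq_or_ne a d with rfl | ha
        · rw [hhd, hkd]
        · simpa [ha] using congrFun e a
      simp only [hiff]
      split_ifs
      · have hV := Vdm_ne_zero hξ.injective
        have hW := Vdm_ne_zero (hξ.shifted_injective h)
        have hW' := Vdm_ne_zero (hξ.shifted_injective (Function.update h d 1))
        rw [shifted_update_one hhd] at hW'
        have ha := hξ.afun_ne_zero hη d
        have hP : ∏ c ∈ Finset.univ.erase d, (shifted η ξ h d - shifted η ξ h c) ≠ 0 :=
          Finset.prod_ne_zero_iff.2 fun c hc =>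
            sub_ne_zero.2 ((hξ.shifted_injective h).ne (Finset.ne_of_mem_erase hc).symm)
        have hup := Vdm_update_mul (shifted η ξ h) d (ξ d - η)
        rw [Finset.prod_mul_distrib, Finset.prod_inv_distrib]
        field_simp
        linear_combination -hup
      · simp
    · have hne : h ≠ k := fun e => by simp [e, hkd] at hhd
      obtain ⟨q, hq⟩ := Tgl2_fusion hη ξ K d
      have h2 := cov2_update_one (K := K) (L0 := L0) hξ (h := Function.update h d 0) (d := d)
        (by simp)
      rw [Function.update_idem, Function.update_eq_self_iff.2 hhd.symm] at h2
      rw [if_neg hne, h2, Matrix.vecMul_vecMul, smul_mul_assoc, hq, Matrix.vecMul_smul,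
        Matrix.vecMul_smul, Matrix.vecMul_one, pair2_smul_left, pair2_smul_left,
        hzero _ (by simp)]
      simp

lemma list_prod_ofFn_mulVec {n : ℕ} {M : Fin n → Op2 N} {s : Fin n → ℂ} {v : Hsp2 N}
    (h : ∀ a, Matrix.mulVec (M a) v = s a • v) :
    Matrix.mulVec (List.ofFn M).prod v = (∏ a, s a) • v := by
  induction n with
  | zero => simp
  | succ n ih =>
    rw [List.ofFn_succ, List.prod_cons, ← Matrix.mulVec_mulVec, ih fun a => h a.succ,
      Matrix.mulVec_smul, h 0, smul_smul, Fin.prod_univ_succ, mul_comm]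

lemma list_prod_ofFn_vecMul {n : ℕ} {M : Fin n → Op2 N} {s : Fin n → ℂ} {v : Hsp2 N}
    (h : ∀ a, Matrix.vecMul v (M a) = s a • v) :
    Matrix.vecMul v (List.ofFn M).prod = (∏ a, s a) • v := by
  induction n with
  | zero => simp
  | succ n ih =>
    rw [List.ofFn_succ, List.prod_cons, ← Matrix.vecMul_vecMul, h 0, Matrix.smul_vecMul,
      ih fun a => h a.succ, smul_smul, Fin.prod_univ_succ]

lemma pow_mulVec {M : Op2 N} {s : ℂ} {v : Hsp2 N} (h : Matrix.mulVec M v = s • v) (n : ℕ) :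
    Matrix.mulVec (M ^ n) v = s ^ n • v := by
  induction n with
  | zero => simp
  | succ n ih =>
    rw [pow_succ, ← Matrix.mulVec_mulVec, h, Matrix.mulVec_smul, ih, smul_smul, pow_succ']

lemma pow_vecMul {M : Op2 N} {s : ℂ} {v : Hsp2 N} (h : Matrix.vecMul v M = s • v) (n : ℕ) :
    Matrix.vecMul v (M ^ n) = s ^ n • v := by
  induction n with
  | zero => simp
  | succ n ih =>
    rw [pow_succ, ← Matrix.vecMul_vecMul, ih, Matrix.smul_vecMul, h, smul_smul, pow_succ]

lemma pair2_cov2_of_eigenvector {t : ℂ → ℂ} {v : Hsp2 N}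
    (hv : ∀ lam, Matrix.mulVec (Tgl2 η ξ K lam) v = t lam • v) (h : St2 N) :
    pair2 (cov2 η ξ K L0 h) v =
      (∏ a, (t (ξ a) / afun η ξ (ξ a)) ^ (h a : ℕ)) * pair2 (cov2 η ξ K L0 zeroSt2) v := by
  rw [cov2_zero, cov2, pair2_vecMul, list_prod_ofFn_mulVec fun a => pow_mulVec
    (s := t (ξ a) / afun η ξ (ξ a)) _ _, pair2_smul_right]
  intro a
  rw [Matrix.smul_mulVec, hv, smul_smul, div_eq_inv_mul]

lemma pair2_vec2_of_eigencovector {t : ℂ → ℂ} {c : Hsp2 N}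
    (hc : ∀ lam, Matrix.vecMul c (Tgl2 η ξ K lam) = t lam • c) (h : St2 N) :
    pair2 c (vec2 η ξ K R1 h) =
      (∏ a, (t (ξ a - η) / afun η ξ (ξ a)) ^ (1 - (h a : ℕ))) * pair2 c R1 := by
  rw [vec2, ← pair2_vecMul, list_prod_ofFn_vecMul fun a => pow_vecMul
    (s := t (ξ a - η) / afun η ξ (ξ a)) _ _, pair2_smul_left]
  intro a
  rw [Matrix.vecMul_smul, hc, smul_smul, div_eq_inv_mul]

end Parameters

end Chain

/-- If a functional `φ` is injective on a nonzero subspace `S`, and `w` is the only candidate for an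
element of `S` with `φ`-value `n`, then `w` is such an element. -/
lemma normalized_iff_eq {E : Type*} [AddCommGroup E] [Module ℂ E] (S : Submodule ℂ E)
    (φ : E →ₗ[ℂ] ℂ) {n : ℂ} {w : E} (hφ : ∀ u ∈ S, φ u = 0 → u = 0)
    (hw : ∀ u ∈ S, φ u = n → u = w) (hS : ∃ u ∈ S, u ≠ 0) (v : E) :
    (v ∈ S ∧ φ v = n) ↔ v = w := by
  refine ⟨fun h => hw v h.1 h.2, ?_⟩
  rintro rfl
  obtain ⟨u, hu, hu0⟩ := hS
  have hne : φ u ≠ 0 := fun h => hu0 (hφ u hu h)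
  have hu' : (n / φ u) • u ∈ S := S.smul_mem _ hu
  have hn : φ ((n / φ u) • u) = n := by simp [hne]
  rw [← hw _ hu' hn]
  exact ⟨hu', hn⟩

/-- gl₂ orthogonal SoV bases.  The SoV vectors form a basis orthogonal to the
SoV co-vector basis with explicit Vandermonde couplings, and transfer matrix eigenstates
(suitably normalized) are exactly the separate states built from the eigenvalue function. -/
theorem statement_16 (N : ℕ) (η : ℂ) (hη : η ≠ 0) (ξ : Fin N → ℂ) (hξ : InhomCond η ξ)
    (K : Matrix (Fin 2) (Fin 2) ℂ)
    (hK : ∀ x : ℂ, K ≠ x • (1 : Matrix (Fin 2) (Fin 2) ℂ))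
    (L0 : Hsp2 N)
    (hbasis : IsBasisFamily2 (cov2 η ξ K L0))
    (R1 : Hsp2 N) (hR1 : DualRef1 η ξ K L0 R1) :
    -- the SoV vectors form a basis
    IsBasisFamily2 (vec2 η ξ K R1) ∧
    -- orthogonality with explicit couplings
    (∀ h k : St2 N,
      pair2 (cov2 η ξ K L0 h) (vec2 η ξ K R1 k) =
        (if h = k then 1 else 0) /
          (Vdm ξ * Vdm fun a => ξ a - ((h a : ℕ) : ℂ) * η)) ∧
    -- SoV representation of the eigenvectors
    (∀ t : ℂ → ℂ,
      (∃ u : Hsp2 N, u ≠ 0 ∧ ∀ lam, Matrix.mulVec (Tgl2 η ξ K lam) u = t lam • u) →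
      ∀ v : Hsp2 N,
        ((∀ lam, Matrix.mulVec (Tgl2 η ξ K lam) v = t lam • v) ∧
            pair2 (cov2 η ξ K L0 zeroSt2) v = (Vdm ξ)⁻¹) ↔
          v = ∑ h : St2 N,
            ((∏ a, (t (ξ a) / afun η ξ (ξ a)) ^ (h a : ℕ)) *
                Vdm fun a => ξ a - ((h a : ℕ) : ℂ) * η) • vec2 η ξ K R1 h) ∧
    -- SoV representation of the eigenco-vectors
    (∀ t : ℂ → ℂ,
      (∃ u : Hsp2 N, u ≠ 0 ∧ ∀ lam, Matrix.vecMul u (Tgl2 η ξ K lam) = t lam • u) →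
      ∀ c : Hsp2 N,
        ((∀ lam, Matrix.vecMul c (Tgl2 η ξ K lam) = t lam • c) ∧
            pair2 c R1 = (Vdm ξ)⁻¹) ↔
          c = ∑ h : St2 N,
            ((∏ a, (t (ξ a - η) / afun η ξ (ξ a)) ^ (1 - (h a : ℕ))) *
                Vdm fun a => ξ a - ((h a : ℕ) : ℂ) * η) • cov2 η ξ K L0 h) := by
  have horth := fun h k => pair2_cov2_vec2 hη hξ hR1 k h
  have hV := Vdm_ne_zero hξ.injective
  have hW := fun h => Vdm_ne_zero (hξ.shifted_injective h)
  have hvec : IsBasisFamily2 (vec2 η ξ K R1) :=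
    isBasisFamily2_of_pair2 (fun h => mul_ne_zero hV (hW h)) horth
  refine ⟨hvec, horth, fun t ht v => ?_, fun t ht c => ?_⟩
  · refine normalized_iff_eq
      { carrier := {v | ∀ lam, Matrix.mulVec (Tgl2 η ξ K lam) v = t lam • v}
        add_mem' := fun ha hb lam => by rw [Matrix.mulVec_add, ha, hb, smul_add]
        zero_mem' := fun lam => by simp
        smul_mem' := fun r x hx lam => by rw [Matrix.mulVec_smul, hx, smul_comm] }
      (dotProductBilin ℂ ℂ (cov2 η ξ K L0 zeroSt2)) (fun u hu h0 => ?_) (fun u hu hn => ?_)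
      (ht.imp fun u hu => ⟨hu.2, hu.1⟩) v
    · refine hbasis.ext_right fun h => ?_
      have h0 : pair2 (cov2 η ξ K L0 zeroSt2) u = 0 := h0
      rw [pair2_cov2_of_eigenvector hu, h0]
      simp [pair2]
    · refine hbasis.ext_right fun h => ?_
      have hn : pair2 (cov2 η ξ K L0 zeroSt2) u = (Vdm ξ)⁻¹ := hn
      have hWh := hW h
      simp only [pair2_cov2_of_eigenvector hu h, hn, pair2_sum_right, pair2_smul_right, horth,
        ite_div, zero_div, mul_ite, mul_zero, Finset.sum_ite_eq, Finset.mem_univ, if_true]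
      change _ = _ * Vdm (shifted η ξ h) * _
      field_simp
  · refine normalized_iff_eq
      { carrier := {c | ∀ lam, Matrix.vecMul c (Tgl2 η ξ K lam) = t lam • c}
        add_mem' := fun ha hb lam => by rw [Matrix.add_vecMul, ha, hb, smul_add]
        zero_mem' := fun lam => by simp
        smul_mem' := fun r x hx lam => by rw [Matrix.smul_vecMul, hx, smul_comm] }
      ((dotProductBilin ℂ ℂ).flip R1) (fun u hu h0 => ?_) (fun u hu hn => ?_)
      (ht.imp fun u hu => ⟨hu.2, hu.1⟩) c
    · refine hvec.ext_left fun h => ?_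
      have h0 : pair2 u R1 = 0 := h0
      rw [pair2_vec2_of_eigencovector hu, h0]
      simp [pair2]
    · refine hvec.ext_left fun h => ?_
      have hn : pair2 u R1 = (Vdm ξ)⁻¹ := hn
      have hWh := hW h
      simp only [pair2_vec2_of_eigencovector hu h, hn, pair2_sum_left, pair2_smul_left, horth,
        ite_div, zero_div, mul_ite, mul_zero, Finset.sum_ite_eq', Finset.mem_univ, if_true]
      change _ = _ * Vdm (shifted η ξ h) * _
      field_simp

end
end SoVgl2
end

section
/- (Explicit off-diagonal coupling for a single (1,1) pair.) Let K be a 3×3 complex matrix with simple spectrum, with SoV covector and vector bases (generic parameters). Fix common labels h₃,…,h_N ∈ {0,1,2} and set h = (0,2,h₃,…,h_N) and k = (1,1,h₃,…,h_N). Then ⟨h|k⟩ = det K · C · ⟨k|k⟩, where C = ( d(ξ₂−η)/d(ξ₁−η) ) · q-det M^{(I)}(ξ₁) · η² / (ξ₁−ξ₂+η)² · ∏_{a=3}^N [ (ξ₁^{(1)} − ξ_a^{(δ_{h_a,2})})·(ξ₂ − ξ_a^{(1−δ_{h_a,0})}) ] / [ (ξ₂^{(1)} − ξ_a^{(δ_{h_a,2})})·(ξ₁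 − ξ_a^{(1−δ_{h_a,0})}) ], with q-det M^{(I)}(λ) = ∏_{b=1}^N (λ−ξ_b+η)(λ−ξ_b−η)(λ−ξ_b−2η) the quantum determinant at identity twist. -/
open scoped BigOperators

namespace SoV

noncomputable section

/-- Quantum states of the gl₃ chain of length `N`: labels of the natural tensor basis
of `H = (ℂ³)^{⊗N}`. -/
abbrev St (N : ℕ) := Fin N → Fin 3
/-- The Hilbert space `H` (and its dual), realized as functions on basis labels. -/
abbrev Hsp (N : ℕ) := St N → ℂ
/-- Operators on `H`. -/
abbrev Op (N : ℕ) := Matrix (St N) (St N) ℂ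

variable {N : ℕ}

/-- ξᵢ − ξⱼ ∉ {0, η, −η} for i ≠ j. -/
def InhomCond (η : ℂ) (ξ : Fin N → ℂ) : Prop :=
  ∀ i j : Fin N, i ≠ j → ξ i - ξ j ≠ 0 ∧ ξ i - ξ j ≠ η ∧ ξ i - ξ j ≠ -η

/-- Vandermonde product `V(x₁,…,x_M) = ∏_{i<j} (x_j − x_i)`. -/
def Vdm {M : ℕ} (x : Fin M → ℂ) : ℂ :=
  ∏ j : Fin M, ∏ i ∈ Finset.univ.filter (fun i => i < j), (x j - x i)

/-- `d(λ) = ∏_a (λ − ξ_a)`. -/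
def dfun (ξ : Fin N → ℂ) (lam : ℂ) : ℂ := ∏ a, (lam - ξ a)

/-- The quantum determinant at identity twist:
`q-det M^{(I)}(λ) = ∏_b (λ−ξ_b+η)(λ−ξ_b−η)(λ−ξ_b−2η)`. -/
def qdetI (η : ℂ) (ξ : Fin N → ℂ) (lam : ℂ) : ℂ :=
  ∏ b, ((lam - ξ b + η) * (lam - ξ b - η) * (lam - ξ b - 2 * η))

/-- The rational gl₃ R-matrix `R_{a,n}(λ − ξ_n) = (λ−ξ_n)·Id + η·P` acting on the
auxiliary space (first factor) and the `n`-th site of the chain. -/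
def Raux (η : ℂ) (ξ : Fin N → ℂ) (lam : ℂ) (n : Fin N) :
    Matrix (Fin 3 × St N) (Fin 3 × St N) ℂ := Matrix.of fun p q =>
  (lam - ξ n) * (if p = q then 1 else 0) +
    η * (if p.1 = q.2 n ∧ p.2 = Function.update q.2 n q.1 then 1 else 0)

/-- The twist matrix `K` acting on the auxiliary space. -/
def Kaux (K : Matrix (Fin 3) (Fin 3) ℂ) :
    Matrix (Fin 3 × St N) (Fin 3 × St N) ℂ := Matrix.of fun p q =>
  K p.1 q.1 * (if p.2 = q.2 then 1 else 0)

/-- The monodromy matrix `M^{(K)}(λ) = K_a R_{a,N}(λ−ξ_N) ⋯ R_{a,1}(λ−ξ_1)`. -/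
def monodromy (η : ℂ) (ξ : Fin N → ℂ) (K : Matrix (Fin 3) (Fin 3) ℂ) (lam : ℂ) :
    Matrix (Fin 3 × St N) (Fin 3 × St N) ℂ :=
  Kaux K * ((List.ofFn fun n : Fin N => Raux η ξ lam n).reverse.prod)

/-- The transfer matrix `T₁^{(K)}(λ) = tr_a M^{(K)}(λ)`. -/
def T1 (η : ℂ) (ξ : Fin N → ℂ) (K : Matrix (Fin 3) (Fin 3) ℂ) (lam : ℂ) : Op N :=
  Matrix.of fun f g => ∑ v : Fin 3, monodromy η ξ K lam (v, f) (v, g)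

/-- Embedding of an (aux ⊗ H)-operator using the first of two auxiliary spaces. -/
def emb1 (M : Matrix (Fin 3 × St N) (Fin 3 × St N) ℂ) :
    Matrix ((Fin 3 × Fin 3) × St N) ((Fin 3 × Fin 3) × St N) ℂ := Matrix.of fun p q =>
  M (p.1.1, p.2) (q.1.1, q.2) * (if p.1.2 = q.1.2 then 1 else 0)

/-- Embedding of an (aux ⊗ H)-operator using the second of two auxiliary spaces. -/
def emb2 (M : Matrix (Fin 3 × St N) (Fin 3 × St N) ℂ) :
    Matrix ((Fin 3 × Fin 3) × St N) ((Fin 3 × Fin 3) × St N) ℂ := Matrix.of fun p q =>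
  M (p.1.2, p.2) (q.1.2, q.2) * (if p.1.1 = q.1.1 then 1 else 0)

/-- The antisymmetrizer `P⁻₁₂` on the two auxiliary spaces (acting trivially on `H`). -/
def antisym2 : Matrix ((Fin 3 × Fin 3) × St N) ((Fin 3 × Fin 3) × St N) ℂ :=
  Matrix.of fun p q =>
    (if p.2 = q.2 then 1 else 0) *
      ((2 : ℂ)⁻¹ * ((if p.1 = q.1 then 1 else 0) - (if p.1 = (q.1.2, q.1.1) then 1 else 0)))

/-- The fused transfer matrix
`T₂^{(K)}(λ) = tr_{12} [P⁻₁₂ M₁^{(K)}(λ) M₂^{(K)}(λ−η)]`. -/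
def T2 (η : ℂ) (ξ : Fin N → ℂ) (K : Matrix (Fin 3) (Fin 3) ℂ) (lam : ℂ) : Op N :=
  Matrix.of fun f g => ∑ v : Fin 3 × Fin 3,
    ((antisym2 * emb1 (monodromy η ξ K lam) * emb2 (monodromy η ξ K (lam - η)) :
      Matrix ((Fin 3 × Fin 3) × St N) ((Fin 3 × Fin 3) × St N) ℂ)) (v, f) (v, g)

/-- A matrix has simple spectrum iff its minimal and characteristic polynomials coincide. -/
def SimpleSpectrum (K : Matrix (Fin 3) (Fin 3) ℂ) : Prop := minpoly ℂ K = K.charpoly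

/-- The conserved-charge product `∏_n T₂^{(K)}(ξ_n−η)^{δ_{h_n,0}} T₁^{(K)}(ξ_n)^{δ_{h_n,2}}`
generating the SoV co-vector basis. -/
def sovCovOp (η : ℂ) (ξ : Fin N → ℂ) (K : Matrix (Fin 3) (Fin 3) ℂ) (h : St N) : Op N :=
  (List.ofFn fun n : Fin N =>
    T2 η ξ K (ξ n - η) ^ (if h n = 0 then 1 else 0) *
      T1 η ξ K (ξ n) ^ (if h n = 2 then 1 else 0)).prod

/-- The SoV co-vector `⟨h| = ⟨1| ∏_n T₂^{(K)}(ξ_n−η)^{δ_{h_n,0}} T₁^{(K)}(ξ_n)^{δ_{h_n,2}}`. -/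
def sovCov (η : ℂ) (ξ : Fin N → ℂ) (K : Matrix (Fin 3) (Fin 3) ℂ) (L : Hsp N) (h : St N) :
    Hsp N := Matrix.vecMul L (sovCovOp η ξ K h)

/-- The conserved-charge product `∏_n T₂^{(K)}(ξ_n)^{δ_{h_n,1}} T₁^{(K)}(ξ_n)^{δ_{h_n,2}}`
generating the SoV vector basis. -/
def sovVecOp (η : ℂ) (ξ : Fin N → ℂ) (K : Matrix (Fin 3) (Fin 3) ℂ) (h : St N) : Op N :=
  (List.ofFn fun n : Fin N =>
    T2 η ξ K (ξ n) ^ (if h n = 1 then 1 else 0) *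
      T1 η ξ K (ξ n) ^ (if h n = 2 then 1 else 0)).prod

/-- The SoV vector `|h⟩ = ∏_n T₂^{(K)}(ξ_n)^{δ_{h_n,1}} T₁^{(K)}(ξ_n)^{δ_{h_n,2}} |0⟩`. -/
def sovVec (η : ℂ) (ξ : Fin N → ℂ) (K : Matrix (Fin 3) (Fin 3) ℂ) (R0 : Hsp N) (h : St N) :
    Hsp N := Matrix.mulVec (sovVecOp η ξ K h) R0

/-- Pairing ⟨L|v⟩ between a co-vector and a vector. -/
def pair (L v : Hsp N) : ℂ := ∑ f, L f * v f

/-- A family of `3^N` (co-)vectors is a basis of `H`. -/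
def IsBasisFamily (v : St N → Hsp N) : Prop :=
  LinearIndependent ℂ v ∧ Submodule.span ℂ (Set.range v) = ⊤

/-- The label `(0,…,0)`. -/
def zeroSt : St N := fun _ => 0

/-- `R0` is the reference vector `|0⟩`, characterized by `⟨k|0⟩ = ∏_a δ_{k_a,0}`. -/
def DualRef (η : ℂ) (ξ : Fin N → ℂ) (K : Matrix (Fin 3) (Fin 3) ℂ) (L R0 : Hsp N) : Prop :=
  ∀ k : St N, pair (sovCov η ξ K L k) R0 = if k = zeroSt then 1 else 0

/-- The diagonal SoV coupling `N_h`. -/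
def Nh (η : ℂ) (ξ : Fin N → ℂ) (h : St N) : ℂ :=
  (∏ a, dfun ξ (ξ a - η) / dfun ξ (ξ a - ((1 : ℂ) + (if h a = 0 then 0 else 1)) * η)) *
    Vdm ξ ^ 2 /
      (Vdm (fun a => ξ a - (if h a = 0 then 0 else 1 : ℂ) * η) *
        Vdm (fun a => ξ a - (if h a = 2 then 1 else 0 : ℂ) * η))

/-- The 3×3 Jordan-type matrix with diagonal `(k₀,k₁,k₂)` and superdiagonal `(y₁,y₂)`. -/
def KJmat (k₀ k₁ k₂ y₁ y₂ : ℂ) : Matrix (Fin 3) (Fin 3) ℂ := !![k₀, y₁, 0; 0, k₁, y₂; 0, 0, k₂]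

/-- `W` conjugates `K` to its Jordan form with data `(k₀,k₁,k₂,y₁,y₂)`. -/
def JordanData (K W : Matrix (Fin 3) (Fin 3) ℂ) (k₀ k₁ k₂ y₁ y₂ : ℂ) : Prop :=
  IsUnit W.det ∧ K = W * KJmat k₀ k₁ k₂ y₁ y₂ * W⁻¹

/-- The tensor product co-vector `⟨L| = (⊗_a (x,y,z)_a)·Γ_W⁻¹`. -/
def tensorCov (W : Matrix (Fin 3) (Fin 3) ℂ) (x y z : ℂ) : Hsp N :=
  fun f => ∏ a, Matrix.vecMul ![x, y, z] W⁻¹ (f a)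

/-- The tensor product vector `|R⟩ = Γ_W·(⊗_a (r,s,t)_aᵗ)`. -/
def tensorVec (W : Matrix (Fin 3) (Fin 3) ℂ) (r s t : ℂ) : Hsp N :=
  fun f => ∏ a, Matrix.mulVec W ![r, s, t] (f a)

/-- `1_k = {a : k_a = 1}`. -/
def ones (k : St N) : Finset (Fin N) := Finset.univ.filter fun a => k a = 1

/-- `n_k = ⌊#1_k / 2⌋`. -/
def nhalf (k : St N) : ℕ := (ones k).card / 2

/-- `k_{α,β}^{(0,2)}`: the label `k` with entries in `α` set to `0` and entries in `β` set to `2`. -/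
def kab (k : St N) (α β : Finset (Fin N)) : St N :=
  fun a => if a ∈ α then 0 else if a ∈ β then 2 else k a

end
end SoV

namespace SoV
noncomputable section

/-- The Lagrange coefficient attached to the node `p b`. -/
def lagr {N : ℕ} (p : Fin N → ℂ) (b : Fin N) (x : ℂ) : ℂ :=
  ∏ c ∈ Finset.univ.erase b, (x - p c) / (p b - p c)

/-- The interpolation and fusion relations of the `gl₃` transfer matrices, in a commutative
algebra. -/
structure FusionSystem {N : ℕ} {R : Type*} [CommRing R] [Algebra ℂ R] (η : ℂ) (ξ q : Fin N → ℂ)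
    (t₁ t₂ : ℂ → R) : Prop where
  interp₁ : ∃ c : ℂ → (Fin N → ℂ) → ℂ, ∀ p : Fin N → ℂ, Function.Injective p → ∀ x,
    t₁ x = c x p • (1 : R) + ∑ b, lagr p b x • t₁ (p b)
  interp₂ : ∃ c : ℂ → (Fin N → ℂ) → ℂ, ∀ p : Fin N → ℂ, Function.Injective p →
    (∀ b, dfun ξ (p b - η) ≠ 0) → ∀ x,
    t₂ x = c x p • (1 : R) +
      ∑ b, (dfun ξ (x - η) / dfun ξ (p b - η) * lagr p b x) • t₂ (p b)
  fuse₁₁ : ∀ a, t₁ (ξ a) * t₁ (ξ a - η) = t₂ (ξ a)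
  fuse₁₂ : ∀ a, t₁ (ξ a) * t₂ (ξ a - η) = q a • (1 : R)

/-- Interpolation nodes for `t₁` adapted to a label. -/
def node₁ {N : ℕ} (η : ℂ) (ξ : Fin N → ℂ) (h : Fin N → Fin 3) (b : Fin N) : ℂ :=
  ξ b - (if h b = 2 then 1 else 0 : ℂ) * η

/-- Interpolation nodes for `t₂` adapted to a label. -/
def node₂ {N : ℕ} (η : ℂ) (ξ : Fin N → ℂ) (h : Fin N → Fin 3) (b : Fin N) : ℂ :=
  ξ b - (if h b = 0 then 0 else 1 : ℂ) * η

section Abstract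

variable {N : ℕ} {R : Type*} [CommRing R] [Algebra ℂ R]

/-- Local factor of the charge product generating the co-vectors. -/
def covFactor (η : ℂ) (ξ : Fin N → ℂ) (t₁ t₂ : ℂ → R) (n : Fin N) (v : Fin 3) : R :=
  t₂ (ξ n - η) ^ (if v = 0 then 1 else 0) * t₁ (ξ n) ^ (if v = 2 then 1 else 0)

/-- Local factor of the charge product generating the vectors. -/
def vecFactor (ξ : Fin N → ℂ) (t₁ t₂ : ℂ → R) (n : Fin N) (v : Fin 3) : R :=
  t₂ (ξ n) ^ (if v = 1 then 1 else 0) * t₁ (ξ n) ^ (if v = 2 then 1 else 0)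

/-- The charge product generating the co-vector with label `h`. -/
def covProd (η : ℂ) (ξ : Fin N → ℂ) (t₁ t₂ : ℂ → R) (h : Fin N → Fin 3) : R :=
  ∏ n, covFactor η ξ t₁ t₂ n (h n)

/-- The charge product generating the vector with label `k`. -/
def vecProd (ξ : Fin N → ℂ) (t₁ t₂ : ℂ → R) (k : Fin N → Fin 3) : R :=
  ∏ n, vecFactor ξ t₁ t₂ n (k n)

omit [Algebra ℂ R] in
lemma prod_update_label (f : Fin N → Fin 3 → R) (h : Fin N → Fin 3) (c : Fin N) :
    ∃ Y : R, ∀ v, ∏ n, f n (Function.update h c v n) = Y * f c v := by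
  refine ⟨∏ n ∈ Finset.univ.erase c, f n (h n), fun v => ?_⟩
  rw [← Finset.prod_erase_mul _ _ (Finset.mem_univ c), Function.update_self]
  congr 1
  refine Finset.prod_congr rfl fun n hn => ?_
  rw [Function.update_of_ne (Finset.ne_of_mem_erase hn)]

variable {η : ℂ} {ξ q : Fin N → ℂ} {t₁ t₂ : ℂ → R}

omit [Algebra ℂ R] in
lemma covProd_update (h : Fin N → Fin 3) (c : Fin N) :
    ∃ Y : R, ∀ v, covProd η ξ t₁ t₂ (Function.update h c v) = Y * covFactor η ξ t₁ t₂ c v :=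
  prod_update_label _ h c

omit [Algebra ℂ R] in
lemma covProd_eq (h : Fin N → Fin 3) (c : Fin N) :
    ∃ Y : R, covProd η ξ t₁ t₂ h = Y * covFactor η ξ t₁ t₂ c (h c) ∧
      ∀ v, covProd η ξ t₁ t₂ (Function.update h c v) = Y * covFactor η ξ t₁ t₂ c v := by
  obtain ⟨Y, hY⟩ := covProd_update (η := η) (ξ := ξ) (t₁ := t₁) (t₂ := t₂) h c
  exact ⟨Y, by simpa using hY (h c), hY⟩

omit [Algebra ℂ R] in
lemma vecProd_eq (h : Fin N → Fin 3) (c : Fin N) :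
    ∃ Y : R, vecProd ξ t₁ t₂ h = Y * vecFactor ξ t₁ t₂ c (h c) ∧
      ∀ v, vecProd ξ t₁ t₂ (Function.update h c v) = Y * vecFactor ξ t₁ t₂ c v := by
  obtain ⟨Y, hY⟩ := prod_update_label (vecFactor ξ t₁ t₂) h c
  exact ⟨Y, by simpa [vecProd] using hY (h c), hY⟩

namespace FusionSystem

variable (S : FusionSystem η ξ q t₁ t₂)
include S

lemma cov_zero_mul_t₁ {h : Fin N → Fin 3} {c : Fin N} (hc : h c = 0) :
    covProd η ξ t₁ t₂ h * t₁ (ξ c) = q c • covProd η ξ t₁ t₂ (Function.update h c 1) := by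
  obtain ⟨Y, h1, h2⟩ := covProd_eq (η := η) (ξ := ξ) (t₁ := t₁) (t₂ := t₂) h c
  have := S.fuse₁₂ c
  rw [h1, h2, hc]
  simp [covFactor, mul_assoc, mul_comm (t₂ _), this]

lemma cov_zero_mul_t₂ {h : Fin N → Fin 3} {c : Fin N} (hc : h c = 0) :
    covProd η ξ t₁ t₂ h * t₂ (ξ c) =
      q c • (covProd η ξ t₁ t₂ (Function.update h c 1) * t₁ (ξ c - η)) := by
  rw [← S.fuse₁₁, ← mul_assoc, S.cov_zero_mul_t₁ hc, smul_mul_assoc]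

omit [Algebra ℂ R] S in
lemma cov_one_mul_t₁ {h : Fin N → Fin 3} {c : Fin N} (hc : h c = 1) :
    covProd η ξ t₁ t₂ h * t₁ (ξ c) = covProd η ξ t₁ t₂ (Function.update h c 2) := by
  obtain ⟨Y, h1, h2⟩ := covProd_eq (η := η) (ξ := ξ) (t₁ := t₁) (t₂ := t₂) h c
  rw [h1, h2, hc]
  simp [covFactor]

omit [Algebra ℂ R] S in
lemma cov_one_mul_t₂ {h : Fin N → Fin 3} {c : Fin N} (hc : h c = 1) :
    covProd η ξ t₁ t₂ h * t₂ (ξ c - η) = covProd η ξ t₁ t₂ (Function.update h c 0) := by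
  obtain ⟨Y, h1, h2⟩ := covProd_eq (η := η) (ξ := ξ) (t₁ := t₁) (t₂ := t₂) h c
  rw [h1, h2, hc]
  simp [covFactor]

lemma cov_two_mul_t₁ {h : Fin N → Fin 3} {c : Fin N} (hc : h c = 2) :
    covProd η ξ t₁ t₂ h * t₁ (ξ c - η) =
      covProd η ξ t₁ t₂ (Function.update h c 1) * t₂ (ξ c) := by
  obtain ⟨Y, h1, h2⟩ := covProd_eq (η := η) (ξ := ξ) (t₁ := t₁) (t₂ := t₂) h c
  have := S.fuse₁₁ c
  rw [h1, h2, hc]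
  simp [covFactor, mul_assoc, this]

lemma cov_two_mul_t₂ {h : Fin N → Fin 3} {c : Fin N} (hc : h c = 2) :
    covProd η ξ t₁ t₂ h * t₂ (ξ c - η) =
      q c • covProd η ξ t₁ t₂ (Function.update h c 1) := by
  obtain ⟨Y, h1, h2⟩ := covProd_eq (η := η) (ξ := ξ) (t₁ := t₁) (t₂ := t₂) h c
  have := S.fuse₁₂ c
  rw [h1, h2, hc]
  simp [covFactor, mul_assoc, this]

lemma vec_two_mul_t₁ {h : Fin N → Fin 3} {c : Fin N} (hc : h c = 2) :
    vecProd ξ t₁ t₂ h * t₁ (ξ c - η) = vecProd ξ t₁ t₂ (Function.update h c 1) := by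
  obtain ⟨Y, h1, h2⟩ := vecProd_eq (ξ := ξ) (t₁ := t₁) (t₂ := t₂) h c
  have := S.fuse₁₁ c
  rw [h1, h2, hc]
  simp [vecFactor, mul_assoc, this]

omit [Algebra ℂ R] S in
lemma vec_zero_mul_t₂ {h : Fin N → Fin 3} {c : Fin N} (hc : h c = 0) :
    vecProd ξ t₁ t₂ h * t₂ (ξ c) = vecProd ξ t₁ t₂ (Function.update h c 1) := by
  obtain ⟨Y, h1, h2⟩ := vecProd_eq (ξ := ξ) (t₁ := t₁) (t₂ := t₂) h c
  rw [h1, h2, hc]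
  simp [vecFactor]

omit [Algebra ℂ R] S in
lemma vec_one_eq {h : Fin N → Fin 3} {c : Fin N} (hc : h c = 1) :
    vecProd ξ t₁ t₂ h = vecProd ξ t₁ t₂ (Function.update h c 0) * t₂ (ξ c) := by
  obtain ⟨Y, h1, h2⟩ := vecProd_eq (ξ := ξ) (t₁ := t₁) (t₂ := t₂) h c
  rw [h1, h2, hc]
  simp [vecFactor]

omit [Algebra ℂ R] S in
lemma vec_two_eq {h : Fin N → Fin 3} {c : Fin N} (hc : h c = 2) :
    vecProd ξ t₁ t₂ h = vecProd ξ t₁ t₂ (Function.update h c 0) * t₁ (ξ c) := by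
  obtain ⟨Y, h1, h2⟩ := vecProd_eq (ξ := ξ) (t₁ := t₁) (t₂ := t₂) h c
  rw [h1, h2, hc]
  simp [vecFactor]

/-- Interpolation of `t₁` under a functional vanishing on all but one node. -/
lemma functional_t₁ (hp : ∀ h, Function.Injective (node₁ η ξ h)) (φ : R →ₗ[ℂ] ℂ) (Y : R)
    (h : Fin N → Fin 3) (x : ℂ) (b : Fin N) (h1 : φ Y = 0)
    (hb : ∀ c, c ≠ b → φ (Y * t₁ (node₁ η ξ h c)) = 0) :
    φ (Y * t₁ x) = lagr (node₁ η ξ h) b x * φ (Y * t₁ (node₁ η ξ h b)) := by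
  obtain ⟨c, hc⟩ := S.interp₁
  rw [hc _ (hp h) x, mul_add, Finset.mul_sum, map_add, map_sum,
    Finset.sum_eq_single_of_mem b (Finset.mem_univ b)]
  · simp [h1]
  · intro a _ ha
    simp [hb a ha]

lemma functional_t₂ (hp : ∀ h, Function.Injective (node₂ η ξ h))
    (hd : ∀ h b, dfun ξ (node₂ η ξ h b - η) ≠ 0) (φ : R →ₗ[ℂ] ℂ) (Y : R)
    (h : Fin N → Fin 3) (x : ℂ) (b : Fin N) (h1 : φ Y = 0)
    (hb : ∀ c, c ≠ b → φ (Y * t₂ (node₂ η ξ h c)) = 0) :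
    φ (Y * t₂ x) = dfun ξ (x - η) / dfun ξ (node₂ η ξ h b - η) * lagr (node₂ η ξ h) b x *
      φ (Y * t₂ (node₂ η ξ h b)) := by
  obtain ⟨c, hc⟩ := S.interp₂
  rw [hc _ (hp h) (hd h) x, mul_add, Finset.mul_sum, map_add, map_sum,
    Finset.sum_eq_single_of_mem b (Finset.mem_univ b)]
  · simp [h1]
  · intro a _ ha
    simp [hb a ha]

lemma functional_t₁_eq_zero (hp : ∀ h, Function.Injective (node₁ η ξ h)) (φ : R →ₗ[ℂ] ℂ) (Y : R)
    (h : Fin N → Fin 3) (x : ℂ) (h1 : φ Y = 0)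
    (hb : ∀ c, φ (Y * t₁ (node₁ η ξ h c)) = 0) : φ (Y * t₁ x) = 0 := by
  obtain ⟨c, hc⟩ := S.interp₁
  rw [hc _ (hp h) x, mul_add, Finset.mul_sum, map_add, map_sum, Finset.sum_eq_zero]
  · simp [h1]
  · intro a _
    simp [hb a]

lemma functional_t₂_eq_zero (hp : ∀ h, Function.Injective (node₂ η ξ h))
    (hd : ∀ h b, dfun ξ (node₂ η ξ h b - η) ≠ 0) (φ : R →ₗ[ℂ] ℂ) (Y : R)
    (h : Fin N → Fin 3) (x : ℂ) (h1 : φ Y = 0)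
    (hb : ∀ c, φ (Y * t₂ (node₂ η ξ h c)) = 0) : φ (Y * t₂ x) = 0 := by
  obtain ⟨c, hc⟩ := S.interp₂
  rw [hc _ (hp h) (hd h) x, mul_add, Finset.mul_sum, map_add, map_sum, Finset.sum_eq_zero]
  · simp [h1]
  · intro a _
    simp [hb a]

end FusionSystem

/-- Products of `m` transfer matrices. -/
inductive Word (t₁ t₂ : ℂ → R) : ℕ → R → Prop
  | one : Word t₁ t₂ 0 1
  | mul₁ {m : ℕ} {X : R} (x : ℂ) : Word t₁ t₂ m X → Word t₁ t₂ (m + 1) (X * t₁ x)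
  | mul₂ {m : ℕ} {X : R} (x : ℂ) : Word t₁ t₂ m X → Word t₁ t₂ (m + 1) (X * t₂ x)

/-- The sites where a label does not vanish. -/
def labelSupp (h : Fin N → Fin 3) : Finset (Fin N) := Finset.univ.filter fun a => h a ≠ 0

/-- The sites where `k` vanishes and `h` does not. -/
def excess (h k : Fin N → Fin 3) : Finset (Fin N) :=
  Finset.univ.filter fun a => k a = 0 ∧ h a ≠ 0

lemma card_labelSupp_update_ne {h : Fin N → Fin 3} {c : Fin N} {v : Fin 3} (hv : v ≠ 0) :
    (labelSupp h).card ≤ (labelSupp (Function.update h c v)).card := by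
  refine Finset.card_le_card fun a ha => ?_
  by_cases hac : a = c
  · subst hac; simpa [labelSupp] using hv
  · simpa [labelSupp, hac] using ha

lemma card_labelSupp_update_zero (h : Fin N → Fin 3) (c : Fin N) :
    (labelSupp h).card ≤ (labelSupp (Function.update h c 0)).card + 1 := by
  refine (Finset.card_le_card fun a ha => ?_).trans (Finset.card_insert_le c _)
  by_cases hac : a = c
  · simp [hac]
  · simpa [labelSupp, hac] using ha

lemma card_ne_one_update {h : Fin N → Fin 3} {c : Fin N} (hc : h c ≠ 1) :
    (Finset.univ.filter fun a => Function.update h c 1 a ≠ 1).card <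
      (Finset.univ.filter fun a => h a ≠ 1).card := by
  refine Finset.card_lt_card ⟨fun a ha => ?_, fun H => ?_⟩
  · by_cases hac : a = c
    · simp [hac] at ha
    · simpa [hac] using ha
  · have := H (by simpa using hc : c ∈ _)
    simp at this

lemma fin3_cases (v : Fin 3) : v = 0 ∨ v = 1 ∨ v = 2 := by
  fin_cases v <;> simp

namespace FusionSystem

variable (S : FusionSystem η ξ q t₁ t₂) (hp₁ : ∀ h, Function.Injective (node₁ η ξ h))
  (hp₂ : ∀ h, Function.Injective (node₂ η ξ h))
  (hd : ∀ h b, dfun ξ (node₂ η ξ h b - η) ≠ 0) (φ : R →ₗ[ℂ] ℂ)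
include S hp₁ hp₂ hd

lemma cov_mul_step {m : ℕ} {X : R}
    (hX : ∀ h, m < (labelSupp h).card → φ (covProd η ξ t₁ t₂ h * X) = 0) (n : ℕ) :
    ∀ h : Fin N → Fin 3, (Finset.univ.filter fun a => h a ≠ 1).card = n →
      m + 1 < (labelSupp h).card → ∀ x,
      φ (covProd η ξ t₁ t₂ h * X * t₁ x) = 0 ∧ φ (covProd η ξ t₁ t₂ h * X * t₂ x) = 0 := by
  induction n using Nat.strong_induction_on with
  | _ n ih =>
    intro h hn hm x
    have key : ∀ c, h c ≠ 1 → ∀ x,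
        φ (covProd η ξ t₁ t₂ (Function.update h c 1) * X * t₁ x) = 0 ∧
        φ (covProd η ξ t₁ t₂ (Function.update h c 1) * X * t₂ x) = 0 := fun c hc x =>
      ih _ (hn ▸ card_ne_one_update hc) _ rfl
        (hm.trans_le (card_labelSupp_update_ne (by decide))) x
    have up : ∀ c (v : Fin 3), v ≠ 0 →
        φ (covProd η ξ t₁ t₂ (Function.update h c v) * X) = 0 := fun c v hv =>
      hX _ (by have := card_labelSupp_update_ne (h := h) (c := c) hv; omega)
    refine ⟨S.functional_t₁_eq_zero hp₁ φ _ h x (hX _ (by omega)) fun c => ?_,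
      S.functional_t₂_eq_zero hp₂ hd φ _ h x (hX _ (by omega)) fun c => ?_⟩
    · rcases fin3_cases (h c) with hc | hc | hc
      · rw [mul_right_comm]
        simp [node₁, hc, S.cov_zero_mul_t₁ hc, up c 1]
      · rw [mul_right_comm]
        simp [node₁, hc, cov_one_mul_t₁ hc, up c 2]
      · rw [mul_right_comm]
        have := (key c (by simp [hc]) (ξ c)).2
        rw [mul_right_comm] at this
        simp [node₁, hc, S.cov_two_mul_t₁ hc, this]
    · rcases fin3_cases (h c) with hc | hc | hc
      · rw [mul_right_comm]
        have := (key c (by simp [hc]) (ξ c - η)).1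
        rw [mul_right_comm] at this
        simp [node₂, hc, S.cov_zero_mul_t₂ hc, this]
      · rw [mul_right_comm]
        have : φ (covProd η ξ t₁ t₂ (Function.update h c 0) * X) = 0 :=
          hX _ (by have := card_labelSupp_update_zero h c; omega)
        simp [node₂, hc, cov_one_mul_t₂ hc, this]
      · rw [mul_right_comm]
        simp [node₂, hc, S.cov_two_mul_t₂ hc, up c 1]

variable (hφ : ∀ h, h ≠ 0 → φ (covProd η ξ t₁ t₂ h) = 0)
include hφ

lemma cov_word_eq_zero {m : ℕ} {X : R} (hX : Word t₁ t₂ m X) :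
    ∀ h, m < (labelSupp h).card → φ (covProd η ξ t₁ t₂ h * X) = 0 := by
  induction hX with
  | one =>
    intro h hm
    rw [mul_one]
    refine hφ h ?_
    rintro rfl
    simp [labelSupp] at hm
  | mul₁ x _ ih =>
    intro h hm
    rw [← mul_assoc]
    exact (S.cov_mul_step hp₁ hp₂ hd φ ih _ h rfl hm x).1
  | mul₂ x _ ih =>
    intro h hm
    rw [← mul_assoc]
    exact (S.cov_mul_step hp₁ hp₂ hd φ ih _ h rfl hm x).2

lemma cov_vec_word_eq_zero (n : ℕ) : ∀ k : Fin N → Fin 3, (labelSupp k).card = n →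
    ∀ (h : Fin N → Fin 3) (m : ℕ) (X : R), Word t₁ t₂ m X → m < (excess h k).card →
    φ (covProd η ξ t₁ t₂ h * vecProd ξ t₁ t₂ k * X) = 0 := by
  induction n with
  | zero =>
    intro k hk h m X hX hm
    have hk0 : k = 0 := by
      funext a
      by_contra ha
      have : a ∈ labelSupp k := by simpa [labelSupp] using ha
      rw [Finset.card_eq_zero.mp hk] at this
      simp at this
    subst hk0
    have h1 : vecProd ξ t₁ t₂ (0 : Fin N → Fin 3) = 1 := by simp [vecProd, vecFactor]
    rw [h1, mul_one]
    refine S.cov_word_eq_zero hp₁ hp₂ hd φ hφ hX h ?_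
    simpa [excess, labelSupp] using hm
  | succ n ih =>
    intro k hk h m X hX hm
    obtain ⟨b, hb⟩ : (labelSupp k).Nonempty := by
      rw [← Finset.card_pos]; omega
    have hkb : k b ≠ 0 := by simpa [labelSupp] using hb
    have hk' : (labelSupp (Function.update k b 0)).card = n := by
      have : labelSupp (Function.update k b 0) = (labelSupp k).erase b := by
        ext a
        by_cases hab : a = b <;> simp [labelSupp, hab]
      rw [this, Finset.card_erase_of_mem hb, hk]
      rfl
    have mono : ∀ h', (∀ a, a ≠ b → h' a = h a) →
        excess h k ⊆ (excess h' (Function.update k b 0)) ∧ b ∉ excess h k := by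
      intro h' hh
      refine ⟨fun a ha => ?_, by simp [excess, hkb]⟩
      have hab : a ≠ b := by rintro rfl; simp [excess, hkb] at ha
      simpa [excess, hab, hh a hab] using ha
    have le : ∀ h', (∀ a, a ≠ b → h' a = h a) → m < (excess h' (Function.update k b 0)).card :=
      fun h' hh => hm.trans_le (Finset.card_le_card (mono h' hh).1)
    have lt : ∀ h', (∀ a, a ≠ b → h' a = h a) → h' b ≠ 0 →
        m + 1 < (excess h' (Function.update k b 0)).card := by
      intro h' hh hb'
      have hsub : insert b (excess h k) ⊆ excess h' (Function.update k b 0) :=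
        Finset.insert_subset (by simp [excess, hb']) (mono h' hh).1
      have := Finset.card_le_card hsub
      rw [Finset.card_insert_of_notMem (mono h' hh).2] at this
      omega
    have hupd : ∀ v a, a ≠ b → Function.update h b v a = h a := fun v a ha => by simp [ha]
    set k' := Function.update k b 0 with hk'def
    rcases fin3_cases (k b) with hc | hc | hc
    · exact absurd hc hkb
    · rw [vec_one_eq hc]
      by_cases h0 : h b = 0
      · have := ih k' hk' _ _ _ (hX.mul₁ (ξ b - η))
          (lt (Function.update h b 1) (hupd 1) (by simp))
        rw [show covProd η ξ t₁ t₂ h * (vecProd ξ t₁ t₂ k' * t₂ (ξ b)) * X =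
          (covProd η ξ t₁ t₂ h * t₂ (ξ b)) * vecProd ξ t₁ t₂ k' * X by ring,
          S.cov_zero_mul_t₂ h0, smul_mul_assoc, smul_mul_assoc, map_smul]
        rw [show covProd η ξ t₁ t₂ (Function.update h b 1) * t₁ (ξ b - η) *
            vecProd ξ t₁ t₂ k' * X = covProd η ξ t₁ t₂ (Function.update h b 1) *
            vecProd ξ t₁ t₂ k' * (X * t₁ (ξ b - η)) by ring, this, smul_zero]
      · have := ih k' hk' _ _ _ (hX.mul₂ (ξ b)) (lt h (fun _ _ => rfl) h0)
        rw [← this]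
        congr 1
        ring
    · rw [vec_two_eq hc]
      rcases fin3_cases (h b) with h0 | h0 | h0
      · have := ih k' hk' _ _ _ hX (le (Function.update h b 1) (hupd 1))
        rw [show covProd η ξ t₁ t₂ h * (vecProd ξ t₁ t₂ k' * t₁ (ξ b)) * X =
          (covProd η ξ t₁ t₂ h * t₁ (ξ b)) * vecProd ξ t₁ t₂ k' * X by ring,
          S.cov_zero_mul_t₁ h0, smul_mul_assoc, smul_mul_assoc, map_smul, this, smul_zero]
      · have := ih k' hk' _ _ _ hX (le (Function.update h b 2) (hupd 2))
        rw [show covProd η ξ t₁ t₂ h * (vecProd ξ t₁ t₂ k' * t₁ (ξ b)) * X =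
          (covProd η ξ t₁ t₂ h * t₁ (ξ b)) * vecProd ξ t₁ t₂ k' * X by ring,
          cov_one_mul_t₁ h0, this]
      · have := ih k' hk' _ _ _ (hX.mul₁ (ξ b)) (lt h (fun _ _ => rfl) (by simp [h0]))
        rw [← this]
        congr 1
        ring

/-- A co-vector and a vector are orthogonal as soon as `k` vanishes at a site where `h` does
not. -/
lemma cov_vec_eq_zero {h k : Fin N → Fin 3} {a : Fin N} (hk : k a = 0) (hh : h a ≠ 0) :
    φ (covProd η ξ t₁ t₂ h * vecProd ξ t₁ t₂ k) = 0 := by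
  have := S.cov_vec_word_eq_zero hp₁ hp₂ hd φ hφ _ k rfl h 0 1 Word.one
    (Finset.card_pos.mpr ⟨a, by simp [excess, hk, hh]⟩)
  rwa [mul_one] at this

/-- The coupling of two labels which differ by the exchange of a pair `(0,2)` with `(1,1)`. -/
lemma coupling_exchange {i j : Fin N} (hij : i ≠ j) {h k : Fin N → Fin 3} (hi : h i = 0)
    (hj : h j = 2) (hk : k = Function.update (Function.update h i 1) j 1) :
    φ (covProd η ξ t₁ t₂ h * vecProd ξ t₁ t₂ k) =
      q i * (lagr (node₁ η ξ (Function.update h i 1)) j (ξ i - η) *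
        (dfun ξ (ξ j - η) / dfun ξ (ξ i - η) *
          lagr (node₂ η ξ (Function.update k i 0)) i (ξ j))) *
      φ (covProd η ξ t₁ t₂ k * vecProd ξ t₁ t₂ k) := by
  have hki : k i = 1 := by simp [hk, hij]
  have hkj : k j = 1 := by simp [hk]
  set h' := Function.update h i 1 with hh'
  set k' := Function.update k i 0 with hk'
  have hi' : h' i = 1 := by simp [hh']
  have hj' : h' j = 2 := by simp [hh', hij.symm, hj]
  have hk'i : k' i = 0 := by simp [hk']
  have hrest : ∀ a, a ≠ i → a ≠ j → h' a = k' a := fun a hai haj => by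
    simp [hk', hk, hai, haj]
  have van : ∀ {l m : Fin N → Fin 3}, m i = 0 → l i ≠ 0 →
      φ (covProd η ξ t₁ t₂ l * vecProd ξ t₁ t₂ m) = 0 := fun hm hl =>
    S.cov_vec_eq_zero hp₁ hp₂ hd φ hφ hm hl
  have first : φ (covProd η ξ t₁ t₂ h' * vecProd ξ t₁ t₂ k' * t₁ (ξ i - η)) =
      lagr (node₁ η ξ h') j (ξ i - η) *
        φ (covProd η ξ t₁ t₂ h' * vecProd ξ t₁ t₂ k' * t₁ (node₁ η ξ h' j)) := by
    refine S.functional_t₁ hp₁ φ _ h' _ j (van hk'i (by simp [hi'])) fun c hcj => ?_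
    by_cases hci : c = i
    · subst hci
      rw [mul_right_comm]
      simp only [node₁, hi', show (1 : Fin 3) ≠ 2 by decide, if_false, zero_mul, sub_zero]
      rw [cov_one_mul_t₁ hi']
      exact van hk'i (by simp)
    · rcases fin3_cases (h' c) with hc | hc | hc
      · rw [mul_right_comm]
        simp only [node₁, hc, show (0 : Fin 3) ≠ 2 by decide, if_false, zero_mul, sub_zero]
        rw [S.cov_zero_mul_t₁ hc, smul_mul_assoc, map_smul, van hk'i, smul_zero]
        simp [hi', Ne.symm hci]
      · rw [mul_right_comm]
        simp only [node₁, hc, show (1 : Fin 3) ≠ 2 by decide, if_false, zero_mul, sub_zero]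
        rw [cov_one_mul_t₁ hc]
        exact van hk'i (by simp [hi', Ne.symm hci])
      · simp only [node₁, hc, if_true, one_mul]
        rw [mul_assoc, S.vec_two_mul_t₁ (by rw [← hrest c hci hcj, hc])]
        exact van (by simp [hk'i, Ne.symm hci]) (by simp [hi'])
  have second : φ (covProd η ξ t₁ t₂ k * vecProd ξ t₁ t₂ k' * t₂ (ξ j)) =
      dfun ξ (ξ j - η) / dfun ξ (node₂ η ξ k' i - η) * lagr (node₂ η ξ k') i (ξ j) *
        φ (covProd η ξ t₁ t₂ k * vecProd ξ t₁ t₂ k' * t₂ (node₂ η ξ k' i)) := by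
    refine S.functional_t₂ hp₂ hd φ _ k' _ i (van hk'i (by simp [hki])) fun c hci => ?_
    have hkc : k c = k' c := by simp [hk', hci]
    rcases fin3_cases (k' c) with hc | hc | hc
    · simp only [node₂, hc, if_true, zero_mul, sub_zero]
      rw [mul_assoc, vec_zero_mul_t₂ hc]
      exact van (by simp [hk'i, Ne.symm hci]) (by simp [hki])
    · rw [mul_right_comm]
      simp only [node₂, hc, show (1 : Fin 3) ≠ 0 by decide, if_false, one_mul]
      rw [cov_one_mul_t₂ (hkc.trans hc)]
      exact van hk'i (by simp [hki, Ne.symm hci])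
    · rw [mul_right_comm]
      simp only [node₂, hc, show (2 : Fin 3) ≠ 0 by decide, if_false, one_mul]
      rw [S.cov_two_mul_t₂ (hkc.trans hc), smul_mul_assoc, map_smul, van hk'i, smul_zero]
      simp [hki, Ne.symm hci]
  have n₁ : node₁ η ξ h' j = ξ j - η := by simp [node₁, hj']
  have n₂ : node₂ η ξ k' i = ξ i := by simp [node₂, hk'i]
  rw [n₁, mul_right_comm, mul_right_comm _ _ (t₁ (ξ j - η)), S.cov_two_mul_t₁ hj', ← hk,
    mul_right_comm, mul_right_comm _ _ (vecProd ξ t₁ t₂ k'), second, n₂] at first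
  rw [vec_one_eq hki, ← hk', show covProd η ξ t₁ t₂ h * (vecProd ξ t₁ t₂ k' * t₂ (ξ i)) =
      (covProd η ξ t₁ t₂ h * t₂ (ξ i)) * vecProd ξ t₁ t₂ k' by ring, S.cov_zero_mul_t₂ hi,
    smul_mul_assoc, map_smul, ← hh', smul_eq_mul,
    mul_right_comm, first, ← mul_assoc (covProd η ξ t₁ t₂ k)]
  ring

end FusionSystem

end Abstract

section Lax

variable {A : Type*} [Ring A] [Algebra ℂ A]

/-- Kronecker symbol. -/
def delta (i j : Fin 3) : ℂ := if i = j then 1 else 0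

/-- A system of matrix units (with transposed multiplication rule) in an algebra. -/
structure IsUnits (e : Fin 3 → Fin 3 → A) : Prop where
  mul : ∀ i j k l, e i j * e k l = delta i l • e k j
  trace : e 0 0 + e 1 1 + e 2 2 = 1

/-- The Lax matrix `u + η P`. -/
def lax (η : ℂ) (e : Fin 3 → Fin 3 → A) (u : ℂ) : Matrix (Fin 3) (Fin 3) A :=
  Matrix.of fun i j => (u * delta i j) • (1 : A) + η • e i j

/-- The exchange relation between two matrices at spectral distance `c`. -/
def Exchange (η c : ℂ) (M M' : Matrix (Fin 3) (Fin 3) A) : Prop :=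
  ∀ i j k l, c • (M i j * M' k l) + η • (M k j * M' i l) =
    c • (M' k l * M i j) + η • (M' k j * M i l)

/-- All entries of two matrices commute. -/
def EntriesCommute (M M' : Matrix (Fin 3) (Fin 3) A) : Prop :=
  ∀ i j k l, Commute (M i j) (M' k l)

/-- Antisymmetry of the product in the row indices. -/
def RowAntisymm (M M' : Matrix (Fin 3) (Fin 3) A) : Prop :=
  ∀ i j k l, M i j * M' k l = -(M k j * M' i l)

/-- Levi-Civita symbol. -/
def eps (i j k : Fin 3) : ℂ :=
  (((j : ℕ) : ℂ) - ((i : ℕ) : ℂ)) * (((k : ℕ) : ℂ) - ((i : ℕ) : ℂ)) *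
    (((k : ℕ) : ℂ) - ((j : ℕ) : ℂ)) / 2

/-- The column-antisymmetrized triple product is the Levi-Civita symbol times `q`. -/
def HasQdet (M M' M'' : Matrix (Fin 3) (Fin 3) A) (q : ℂ) : Prop :=
  ∀ i k l, ∑ p, ∑ r, ∑ t, eps p r t • (M i p * M' k r * M'' l t) = (eps i k l * q) • (1 : A)

/-- Column-antisymmetrized product of two matrices. -/
def colWedge (M M' : Matrix (Fin 3) (Fin 3) A) (i k j l : Fin 3) : A :=
  M i j * M' k l - M i l * M' k j

variable {η : ℂ} {e : Fin 3 → Fin 3 → A}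

lemma lax_exchange (he : IsUnits e) (u v : ℂ) : Exchange η (u - v) (lax η e u) (lax η e v) := by
  intro i j k l
  simp only [lax, Matrix.of_apply, mul_add, add_mul, smul_mul_smul_comm, he.mul, mul_one, one_mul]
  generalize delta i j = a, delta k l = b, delta k j = c, delta i l = d
  module

lemma lax_rowAntisymm (he : IsUnits e) : RowAntisymm (lax η e 0) (lax η e (-η)) := by
  intro i j k l
  simp only [lax, Matrix.of_apply, mul_add, add_mul, smul_mul_smul_comm, he.mul, mul_one, one_mul]
  generalize delta i j = a, delta k l = b, delta k j = c, delta i l = d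
  module

lemma sum_eps_smul (f : Fin 3 → Fin 3 → Fin 3 → A) :
    ∑ p, ∑ r, ∑ t, eps p r t • f p r t =
      f 0 1 2 - f 0 2 1 - f 1 0 2 + f 1 2 0 + f 2 0 1 - f 2 1 0 := by
  simp only [Fin.sum_univ_three, eps]
  norm_num
  module

lemma lax_hasQdet (he : IsUnits e) (u : ℂ) :
    HasQdet (lax η e u) (lax η e (u - η)) (lax η e (u - 2 * η))
      ((u + η) * (u - η) * (u - 2 * η)) := by
  have h2 : e 2 2 = 1 - e 0 0 - e 1 1 := by rw [← he.trace]; abel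
  intro i k l
  rw [sum_eps_smul]
  simp only [lax, Matrix.of_apply, mul_add, add_mul, he.mul, mul_one, one_mul,
    smul_smul, mul_smul_comm, smul_mul_assoc, smul_add]
  fin_cases i <;> fin_cases k <;> fin_cases l <;>
  simp [delta, eps, h2] <;> module

omit [Algebra ℂ A] in
lemma mul_apply_mul_mul_apply {M M' B B' : Matrix (Fin 3) (Fin 3) A} (h₁ : EntriesCommute B M')
    (i j k l : Fin 3) :
    (M * B) i j * (M' * B') k l = ∑ p, ∑ r, M i p * M' k r * (B p j * B' r l) := by
  simp only [Matrix.mul_apply, Finset.sum_mul, Finset.mul_sum]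
  rw [Finset.sum_comm]
  refine Finset.sum_congr rfl fun p _ => Finset.sum_congr rfl fun r _ => ?_
  rw [mul_assoc, ← mul_assoc (B _ _), (h₁ _ _ _ _).eq]
  simp only [mul_assoc]

lemma Exchange.mul {c : ℂ} {M M' B B' : Matrix (Fin 3) (Fin 3) A} (hM : Exchange η c M M')
    (hB : Exchange η c B B') (h₁ : EntriesCommute B M') (h₂ : EntriesCommute B' M) :
    Exchange η c (M * B) (M' * B') := by
  intro i j k l
  have e₂ : ∀ i j k l, (M' * B') k l * (M * B) i j =
      ∑ p, ∑ r, M' k r * M i p * (B' r l * B p j) := by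
    intro i j k l
    rw [mul_apply_mul_mul_apply h₂, Finset.sum_comm]
  rw [mul_apply_mul_mul_apply h₁, mul_apply_mul_mul_apply h₁, e₂, e₂]
  calc _ = ∑ p, ∑ r, (c • (M i p * M' k r) + η • (M k p * M' i r)) * (B p j * B' r l) := by
        simp only [Finset.smul_sum, ← Finset.sum_add_distrib, add_mul, smul_mul_assoc]
    _ = ∑ p, ∑ r, (c • (M' k r * M i p)) * (B p j * B' r l) +
          ∑ p, ∑ r, η • (M' k p * M i r) * (B p j * B' r l) := by
        simp only [← Finset.sum_add_distrib, ← add_mul]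
        simp only [hM _ _ _ _]
    _ = ∑ p, ∑ r, (c • (M' k r * M i p)) * (B p j * B' r l) +
          ∑ p, ∑ r, η • (M' k r * M i p) * (B r j * B' p l) := by
        congr 1
        rw [Finset.sum_comm]
    _ = ∑ p, ∑ r, (M' k r * M i p) * (c • (B p j * B' r l) + η • (B r j * B' p l)) := by
        simp only [← Finset.sum_add_distrib, mul_add, smul_mul_assoc, mul_smul_comm]
    _ = _ := by
        simp only [hB _ _ _ _]
        simp only [Finset.smul_sum, ← Finset.sum_add_distrib, mul_add, mul_smul_comm]

lemma Exchange.rowAntisymm_mul (hη : η ≠ 0) {M M' B B' : Matrix (Fin 3) (Fin 3) A}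
    (hM : Exchange η η M M') (hB : RowAntisymm B B') (h₁ : EntriesCommute B M') :
    RowAntisymm (M * B) (M' * B') := by
  intro i j k l
  rw [eq_neg_iff_add_eq_zero, mul_apply_mul_mul_apply h₁, mul_apply_mul_mul_apply h₁]
  have hM' : ∀ i j k l, M i j * M' k l + M k j * M' i l = M' k l * M i j + M' k j * M i l :=
    fun i j k l => smul_right_injective A hη (by simpa [smul_add] using hM i j k l)
  calc _ = ∑ p, ∑ r, (M i p * M' k r + M k p * M' i r) * (B p j * B' r l) := by
        simp only [← Finset.sum_add_distrib, add_mul]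
    _ = ∑ p, ∑ r, (M' k r * M i p) * (B p j * B' r l) +
          ∑ p, ∑ r, (M' k p * M i r) * (B p j * B' r l) := by
        simp only [← Finset.sum_add_distrib, ← add_mul, hM']
    _ = ∑ p, ∑ r, (M' k r * M i p) * (B p j * B' r l) +
          ∑ p, ∑ r, (M' k r * M i p) * (B r j * B' p l) := by
        congr 1
        rw [Finset.sum_comm]
    _ = 0 := by
        simp only [← Finset.sum_add_distrib, ← mul_add]
        refine Finset.sum_eq_zero fun p _ => Finset.sum_eq_zero fun r _ => ?_
        rw [hB p j r l, neg_add_cancel, mul_zero]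

omit [Algebra ℂ A] in
lemma RowAntisymm.mul {M M' B B' : Matrix (Fin 3) (Fin 3) A} (hM : RowAntisymm M M')
    (h₁ : EntriesCommute B M') : RowAntisymm (M * B) (M' * B') := by
  intro i j k l
  rw [mul_apply_mul_mul_apply h₁, mul_apply_mul_mul_apply h₁]
  simp only [hM i _ k _, neg_mul, Finset.sum_neg_distrib]

lemma HasQdet.mul {M M' M'' B B' B'' : Matrix (Fin 3) (Fin 3) A} {q r : ℂ}
    (hM : HasQdet M M' M'' q) (hB : HasQdet B B' B'' r) (h₁ : EntriesCommute B M')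
    (h₂ : EntriesCommute B M'') (h₃ : EntriesCommute B' M'') :
    HasQdet (M * B) (M' * B') (M'' * B'') (q * r) := by
  intro i k l
  have key : ∀ p s t, (M * B) i p * (M' * B') k s * (M'' * B'') l t =
      ∑ a, ∑ b, ∑ c, M i a * M' k b * M'' l c * (B a p * B' b s * B'' c t) := by
    intro p s t
    rw [mul_apply_mul_mul_apply h₁, Matrix.mul_apply, Finset.sum_mul]
    refine Finset.sum_congr rfl fun a _ => ?_
    rw [Finset.sum_mul]
    refine Finset.sum_congr rfl fun b _ => ?_
    rw [Finset.mul_sum]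
    refine Finset.sum_congr rfl fun c _ => ?_
    have : Commute (B a p * B' b s) (M'' l c) := (h₂ _ _ _ _).mul_left (h₃ _ _ _ _)
    rw [mul_assoc, ← mul_assoc (B a p * B' b s), this.eq]
    simp only [mul_assoc]
  calc _ = ∑ a, ∑ b, ∑ c, M i a * M' k b * M'' l c *
        ∑ p, ∑ s, ∑ t, eps p s t • (B a p * B' b s * B'' c t) := by
        simp only [key, sum_eps_smul, ← Finset.sum_sub_distrib, ← Finset.sum_add_distrib,
          mul_sub, mul_add]
    _ = r • ∑ a, ∑ b, ∑ c, eps a b c • (M i a * M' k b * M'' l c) := by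
        simp only [hB _ _ _, Finset.smul_sum, mul_smul_comm, mul_one, smul_smul, mul_comm r]
    _ = _ := by
        rw [hM, smul_smul]
        congr 1
        ring

/-- A scalar matrix with entries in the algebra. -/
def twist (K : Matrix (Fin 3) (Fin 3) ℂ) : Matrix (Fin 3) (Fin 3) A :=
  Matrix.of fun i j => K i j • (1 : A)

lemma twist_exchange (K : Matrix (Fin 3) (Fin 3) ℂ) (c : ℂ) :
    Exchange η c (twist K : Matrix _ _ A) (twist K) := by
  intro i j k l
  simp only [twist, Matrix.of_apply, smul_mul_smul_comm, mul_one]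
  module

lemma twist_commute (K : Matrix (Fin 3) (Fin 3) ℂ) (M : Matrix (Fin 3) (Fin 3) A) :
    EntriesCommute M (twist K) := fun _ _ _ _ => by
  simpa [twist] using (Commute.one_right _).smul_right _

lemma twist_hasQdet (K : Matrix (Fin 3) (Fin 3) ℂ) :
    HasQdet (twist K : Matrix _ _ A) (twist K) (twist K) K.det := by
  intro i k l
  rw [sum_eps_smul]
  simp only [twist, Matrix.of_apply, smul_mul_smul_comm, mul_one, ← sub_smul, ← add_smul]
  congr 1
  rw [Matrix.det_fin_three]
  fin_cases i <;> fin_cases k <;> fin_cases l <;> simp [eps] <;> ring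

lemma Exchange.colWedge_swap (hη : η ≠ 0) {M M' : Matrix (Fin 3) (Fin 3) A}
    (hM : Exchange η η M M') (i k j l : Fin 3) : colWedge M M' i k j l = -colWedge M M' k i j l := by
  have hM' : ∀ i j k l, M i j * M' k l + M k j * M' i l = M' k l * M i j + M' k j * M i l :=
    fun i j k l => smul_right_injective A hη (by simpa [smul_add] using hM i j k l)
  have := (hM' i j k l).trans ((add_comm _ _).trans (hM' i l k j).symm)
  rw [colWedge, colWedge]
  rw [← sub_eq_zero] at this ⊢
  rw [← this]
  module

omit [Algebra ℂ A] in
lemma colWedge_swap_right (M M' : Matrix (Fin 3) (Fin 3) A) (i k j l : Fin 3) :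
    colWedge M M' i k l j = -colWedge M M' i k j l := by
  simp [colWedge]

lemma Exchange.colWedge_mul (hη : η ≠ 0) {M M' B B' : Matrix (Fin 3) (Fin 3) A}
    (hB : Exchange η η B B') (h₁ : EntriesCommute B M') (i k j l : Fin 3) :
    colWedge (M * B) (M' * B') i k j l =
      (2⁻¹ : ℂ) • ∑ p, ∑ r, colWedge M M' i k p r * colWedge B B' p r j l := by
  have e : colWedge (M * B) (M' * B') i k j l =
      ∑ p, ∑ r, M i p * M' k r * colWedge B B' p r j l := by
    rw [colWedge, mul_apply_mul_mul_apply h₁, mul_apply_mul_mul_apply h₁]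
    simp only [← Finset.sum_sub_distrib, ← mul_sub, colWedge]
  have e' : ∑ p, ∑ r, M i r * M' k p * colWedge B B' p r j l =
      -∑ p, ∑ r, M i p * M' k r * colWedge B B' p r j l := by
    rw [Finset.sum_comm]
    simp only [← Finset.sum_neg_distrib, ← mul_neg, ← hB.colWedge_swap hη]
  have : ∑ p, ∑ r, colWedge M M' i k p r * colWedge B B' p r j l =
      ∑ p, ∑ r, M i p * M' k r * colWedge B B' p r j l -
        ∑ p, ∑ r, M i r * M' k p * colWedge B B' p r j l := by
    simp only [← Finset.sum_sub_distrib, ← sub_mul]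
    rfl
  rw [this, e', e]
  module

/-- The nontrivial factor of the antisymmetrized product of two Lax matrices. -/
def laxWedge (η : ℂ) (e : Fin 3 → Fin 3 → A) (u : ℂ) (i k j l : Fin 3) : A :=
  (u * (delta i j * delta k l - delta i l * delta k j)) • (1 : A) +
    η • (delta i j • e k l - delta i l • e k j + delta k l • e i j - delta k j • e i l)

lemma colWedge_lax (he : IsUnits e) (u : ℂ) (i k j l : Fin 3) :
    colWedge (lax η e u) (lax η e (u - η)) i k j l = (u - η) • laxWedge η e u i k j l := by
  simp only [colWedge, laxWedge, lax, Matrix.of_apply, mul_add, add_mul, smul_mul_smul_comm,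
    he.mul, mul_one, one_mul]
  generalize delta i j = a, delta k l = b, delta k j = c, delta i l = d
  module

lemma trace_commute {u v : ℂ} {M M' : Matrix (Fin 3) (Fin 3) A} (huv : u ≠ v)
    (h₁ : Exchange η (u - v) M M') (h₂ : Exchange η (v - u) M' M) :
    Commute M.trace M'.trace := by
  have hc : u - v ≠ 0 := sub_ne_zero.mpr huv
  have s₁ : (u - v) • (M.trace * M'.trace - M'.trace * M.trace) =
      η • (∑ i, ∑ k, M' k i * M i k - ∑ i, ∑ k, M k i * M' i k) := by
    simp only [Matrix.trace, Matrix.diag, Finset.sum_mul_sum]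
    rw [Finset.sum_comm (f := fun i j => M' i i * M j j)]
    simp only [← Finset.sum_sub_distrib, Finset.smul_sum]
    refine Finset.sum_congr rfl fun i _ => Finset.sum_congr rfl fun k _ => ?_
    have := h₁ i i k k
    rw [← sub_eq_zero] at this ⊢
    rw [← this]
    module
  have s₂ : (v - u) • (M'.trace * M.trace - M.trace * M'.trace) =
      η • (∑ i, ∑ k, M k i * M' i k - ∑ i, ∑ k, M' k i * M i k) := by
    simp only [Matrix.trace, Matrix.diag, Finset.sum_mul_sum]
    rw [Finset.sum_comm (f := fun i j => M i i * M' j j)]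
    simp only [← Finset.sum_sub_distrib, Finset.smul_sum]
    refine Finset.sum_congr rfl fun i _ => Finset.sum_congr rfl fun k _ => ?_
    have := h₂ i i k k
    rw [← sub_eq_zero] at this ⊢
    rw [← this]
    module
  have s₃ : ((2 : ℂ) * (u - v)) • (M.trace * M'.trace - M'.trace * M.trace) = 0 := by
    calc _ = (u - v) • (M.trace * M'.trace - M'.trace * M.trace) +
        (v - u) • (M'.trace * M.trace - M.trace * M'.trace) := by module
      _ = 0 := by rw [s₁, s₂]; module
  exact sub_eq_zero.mp ((smul_eq_zero.mp s₃).resolve_left (mul_ne_zero two_ne_zero hc))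

/-- The quadratic fused trace. -/
def wedgeTrace (M M' : Matrix (Fin 3) (Fin 3) A) : A :=
  (2⁻¹ : ℂ) • ∑ i, ∑ k, colWedge M M' i k i k

lemma RowAntisymm.trace_mul_trace {M M' : Matrix (Fin 3) (Fin 3) A} (h : RowAntisymm M M') :
    M.trace * M'.trace = wedgeTrace M M' := by
  have : ∑ i, ∑ k, colWedge M M' i k i k = (2 : ℂ) • (M.trace * M'.trace) := by
    simp only [colWedge, Matrix.trace, Matrix.diag, Finset.sum_mul_sum, two_smul]
    nth_rw 3 [Finset.sum_comm]
    simp only [← Finset.sum_add_distrib]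
    refine Finset.sum_congr rfl fun i _ => Finset.sum_congr rfl fun k _ => ?_
    rw [h i k k i, sub_neg_eq_add]
  rw [wedgeTrace, this, smul_smul]
  norm_num

lemma RowAntisymm.trace_mul_wedgeTrace (hη : η ≠ 0) {M M' M'' : Matrix (Fin 3) (Fin 3) A} {q : ℂ}
    (h : RowAntisymm M M') (h' : Exchange η η M' M'') (hq : HasQdet M M' M'' q) :
    M.trace * wedgeTrace M' M'' = q • (1 : A) := by
  set W : Fin 3 → Fin 3 → Fin 3 → Fin 3 → Fin 3 → Fin 3 → A :=
    fun i k l j r s => M i j * colWedge M' M'' k l r s with hW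
  have w₁ : ∀ i k l j r s, W i k l j r s = -W k i l j r s := by
    intro i k l j r s
    simp only [hW, colWedge, mul_sub, ← mul_assoc, h i j k _]
    noncomm_ring
  have w₂ : ∀ i k l j r s, W i k l j r s = -W i l k j r s := by
    intro i k l j r s
    simp only [hW]
    rw [h'.colWedge_swap hη, mul_neg]
  have z : ∀ {x : A}, x = -x → x = 0 := fun {x} hx => by
    have : (2 : ℂ) • x = 0 := by rw [two_smul]; nth_rw 1 [hx]; simp
    exact (smul_eq_zero.mp this).resolve_left two_ne_zero
  have z₁ : ∀ i l j r s, W i i l j r s = 0 := fun i l j r s => z (w₁ i i l j r s)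
  have z₂ : ∀ i l j r s, W i l l j r s = 0 := fun i l j r s => z (w₂ i l l j r s)
  have z₃ : ∀ i l j r s, W i l i j r s = 0 := fun i l j r s => by rw [w₂, z₁, neg_zero]
  have w₃ : ∀ j r s, W 0 1 2 j s r = -W 0 1 2 j r s := fun j r s => by
    simp only [hW]
    rw [colWedge_swap_right, mul_neg]
  have hq' : W 0 1 2 0 1 2 - W 0 1 2 1 0 2 + W 0 1 2 2 0 1 = q • (1 : A) := by
    have := hq 0 1 2
    rw [sum_eps_smul] at this
    simp only [hW, colWedge]
    rw [show q = eps 0 1 2 * q by norm_num [eps], ← this]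
    noncomm_ring
  have e : M.trace * wedgeTrace M' M'' = (2⁻¹ : ℂ) • ∑ i, ∑ k, ∑ l, W i k l i k l := by
    rw [wedgeTrace, mul_smul_comm]
    rw [Matrix.trace, Finset.sum_mul]
    simp only [Matrix.diag, Finset.mul_sum, hW]
  have r₁ : W 0 2 1 0 2 1 = W 0 1 2 0 1 2 := by rw [w₂, w₃, neg_neg]
  have r₂ : W 1 0 2 1 0 2 = -W 0 1 2 1 0 2 := by rw [w₁]
  have r₃ : W 1 2 0 1 2 0 = -W 0 1 2 1 0 2 := by rw [w₂, w₁, neg_neg, w₃]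
  have r₄ : W 2 0 1 2 0 1 = W 0 1 2 2 0 1 := by rw [w₁, w₂, neg_neg]
  have r₅ : W 2 1 0 2 1 0 = W 0 1 2 2 0 1 := by rw [w₂, w₁, neg_neg, w₂, w₃, neg_neg]
  rw [e, ← hq']
  simp only [Fin.sum_univ_three, z₁, z₂, z₃, r₁, r₂, r₃, r₄, r₅]
  module

end Lax

section Degree

variable {A : Type*} [Ring A] [Algebra ℂ A]

variable (A) in
/-- Algebra-valued polynomial functions of degree less than `n`. -/
def polyLT (n : ℕ) : Submodule ℂ (ℂ → A) :=
  Submodule.span ℂ {f | ∃ i < n, ∃ a : A, f = fun x => x ^ i • a}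

/-- Algebra-valued polynomial functions of degree at most `n` whose coefficient of degree `n`
is scalar. -/
def HasScalarLead (n : ℕ) (f : ℂ → A) : Prop :=
  ∃ c : ℂ, (fun x => f x - (c * x ^ n) • (1 : A)) ∈ polyLT A n

lemma pow_smul_mem_polyLT {n i : ℕ} (hi : i < n) (a : A) :
    (fun x : ℂ => x ^ i • a) ∈ polyLT A n :=
  Submodule.subset_span ⟨i, hi, a, rfl⟩

lemma mul_mem_polyLT {n : ℕ} {f : ℂ → A} (hf : f ∈ polyLT A n) (b : A) :
    (fun x => b * f x) ∈ polyLT A n := by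
  induction hf using Submodule.span_induction with
  | mem f hf =>
    obtain ⟨i, hi, a, rfl⟩ := hf
    simpa using pow_smul_mem_polyLT hi (b * a)
  | zero =>
    simp only [Pi.zero_apply, mul_zero]
    exact (polyLT A n).zero_mem
  | add f g _ _ hf hg =>
    simp only [Pi.add_apply, mul_add]
    exact (polyLT A n).add_mem hf hg
  | smul c f _ hf =>
    simp only [Pi.smul_apply, mul_smul_comm]
    exact (polyLT A n).smul_mem c hf

lemma smul_mem_polyLT_succ {n : ℕ} {f : ℂ → A} (hf : f ∈ polyLT A n) :
    (fun x => x • f x) ∈ polyLT A (n + 1) := by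
  induction hf using Submodule.span_induction with
  | mem f hf =>
    obtain ⟨i, hi, a, rfl⟩ := hf
    simpa [smul_smul, pow_succ'] using pow_smul_mem_polyLT (Nat.succ_lt_succ hi) a
  | zero =>
    simp only [Pi.zero_apply, smul_zero]
    exact (polyLT A (n + 1)).zero_mem
  | add f g _ _ hf hg =>
    simp only [Pi.add_apply, smul_add]
    exact (polyLT A (n + 1)).add_mem hf hg
  | smul c f _ hf =>
    simp only [Pi.smul_apply, smul_comm _ c]
    exact (polyLT A (n + 1)).smul_mem c hf

lemma polyLT_mono {n m : ℕ} (h : n ≤ m) : polyLT A n ≤ polyLT A m :=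
  Submodule.span_mono fun _ ⟨i, hi, a, ha⟩ => ⟨i, hi.trans_le h, a, ha⟩

namespace HasScalarLead

variable {n : ℕ} {f g : ℂ → A}

lemma one : HasScalarLead 0 (fun _ => (1 : A)) :=
  ⟨1, by simp only [pow_zero, mul_one, one_smul, sub_self]; exact (polyLT A 0).zero_mem⟩

lemma zero : HasScalarLead n (fun _ => (0 : A)) :=
  ⟨0, by simp only [zero_mul, zero_smul, sub_self]; exact (polyLT A n).zero_mem⟩

lemma add (hf : HasScalarLead n f) (hg : HasScalarLead n g) :
    HasScalarLead n (fun x => f x + g x) := by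
  obtain ⟨c, hc⟩ := hf
  obtain ⟨d, hd⟩ := hg
  refine ⟨c + d, ?_⟩
  convert (polyLT A n).add_mem hc hd using 1
  funext x
  simp only [Pi.add_apply]
  module

lemma smul (hf : HasScalarLead n f) (a : ℂ) : HasScalarLead n (fun x => a • f x) := by
  obtain ⟨c, hc⟩ := hf
  refine ⟨a * c, ?_⟩
  convert (polyLT A n).smul_mem a hc using 1
  funext x
  simp only [Pi.smul_apply]
  module

lemma sum {ι : Type*} (s : Finset ι) {F : ι → ℂ → A} (hF : ∀ i ∈ s, HasScalarLead n (F i)) :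
    HasScalarLead n (fun x => ∑ i ∈ s, F i x) := by
  classical
  induction s using Finset.induction_on with
  | empty => simpa using zero
  | insert a s ha ih =>
    simp only [Finset.sum_insert ha]
    exact (hF a (by simp)).add (ih fun i hi => hF i (by simp [hi]))

lemma linear_mul (hf : HasScalarLead n f) (s : ℂ) (b : A) :
    HasScalarLead (n + 1) (fun x => ((s * x) • (1 : A) + b) * f x) := by
  obtain ⟨c, hc⟩ := hf
  refine ⟨s * c, ?_⟩
  have h₁ := (polyLT A (n + 1)).smul_mem s (smul_mem_polyLT_succ hc)
  have h₂ := polyLT_mono (Nat.le_succ n) (mul_mem_polyLT hc b)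
  have h₃ := pow_smul_mem_polyLT (Nat.lt_succ_self n) (c • b)
  convert (polyLT A (n + 1)).add_mem ((polyLT A (n + 1)).add_mem h₁ h₂) h₃ using 1
  funext x
  simp only [Pi.add_apply, Pi.smul_apply, add_mul, smul_mul_assoc, one_mul, mul_sub,
    mul_smul_comm, mul_one]
  module

end HasScalarLead

lemma lagr_eq_eval {N : ℕ} (p : Fin N → ℂ) (b : Fin N) (x : ℂ) :
    lagr p b x = (Lagrange.basis Finset.univ p b).eval x := by
  rw [lagr, Lagrange.basis, Polynomial.eval_prod]
  refine Finset.prod_congr rfl fun c _ => ?_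
  simp [Lagrange.basisDivisor, div_eq_inv_mul]

lemma sum_lagr_mul_pow {N : ℕ} {p : Fin N → ℂ} (hp : Function.Injective p) {i : ℕ} (hi : i < N)
    (x : ℂ) : ∑ b, lagr p b x * p b ^ i = x ^ i := by
  have h := Lagrange.eq_interpolate (s := Finset.univ) (v := p) (f := Polynomial.X ^ i)
    hp.injOn (by
      rw [Polynomial.degree_X_pow, Finset.card_univ, Fintype.card_fin]
      exact_mod_cast hi)
  have h' := congrArg (Polynomial.eval x) h
  simp only [Lagrange.interpolate_apply, Polynomial.eval_finsetSum, Polynomial.eval_mul,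
    Polynomial.eval_C, Polynomial.eval_pow, Polynomial.eval_X] at h'
  rw [h']
  exact Finset.sum_congr rfl fun b _ => by rw [lagr_eq_eval, mul_comm]

lemma polyLT_interpolate {N : ℕ} {p : Fin N → ℂ} (hp : Function.Injective p) {f : ℂ → A}
    (hf : f ∈ polyLT A N) (x : ℂ) : f x = ∑ b, lagr p b x • f (p b) := by
  induction hf using Submodule.span_induction with
  | mem f hf =>
    obtain ⟨i, hi, a, rfl⟩ := hf
    simp only [smul_smul, ← Finset.sum_smul, sum_lagr_mul_pow hp hi]
  | zero => simp
  | add f g _ _ hf hg => simp only [Pi.add_apply, smul_add, Finset.sum_add_distrib, ← hf, ← hg]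
  | smul c f _ hf => simp only [Pi.smul_apply, smul_comm _ c, ← Finset.smul_sum, ← hf]

lemma HasScalarLead.interpolate {N : ℕ} {f : ℂ → A} (hf : HasScalarLead N f) :
    ∃ c : ℂ → (Fin N → ℂ) → ℂ, ∀ p : Fin N → ℂ, Function.Injective p → ∀ x,
      f x = c x p • (1 : A) + ∑ b, lagr p b x • f (p b) := by
  obtain ⟨c, hc⟩ := hf
  refine ⟨fun x p => c * x ^ N - ∑ b, lagr p b x * (c * p b ^ N), fun p hp x => ?_⟩
  have := polyLT_interpolate hp hc x
  simp only [smul_sub, Finset.sum_sub_distrib, smul_smul, ← Finset.sum_smul] at this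
  rw [sub_eq_iff_eq_add] at this
  rw [this]
  module

end Degree

section Chain

variable {A : Type*} [Ring A] [Algebra ℂ A] {ι : Type*} {η : ℂ} {ξ : ι → ℂ}
  {e : ι → Fin 3 → Fin 3 → A}

/-- The ordered product of Lax matrices along a list of sites. -/
def laxProd (η : ℂ) (ξ : ι → ℂ) (e : ι → Fin 3 → Fin 3 → A) (l : List ι) (x : ℂ) :
    Matrix (Fin 3) (Fin 3) A :=
  (l.map fun n => lax η (e n) (x - ξ n)).prod

lemma laxProd_cons (n : ι) (l : List ι) (x : ℂ) :
    laxProd η ξ e (n :: l) x = lax η (e n) (x - ξ n) * laxProd η ξ e l x := by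
  simp [laxProd]

lemma laxProd_nil (x : ℂ) : laxProd η ξ e [] x = 1 := rfl

omit [Algebra ℂ A] in
lemma entriesCommute_one (M : Matrix (Fin 3) (Fin 3) A) : EntriesCommute 1 M := by
  intro i j k l
  rw [Matrix.one_apply]
  split_ifs
  exacts [Commute.one_left _, Commute.zero_left _]

lemma twist_one : (twist 1 : Matrix (Fin 3) (Fin 3) A) = 1 := by
  ext i j
  simp only [twist, Matrix.of_apply, Matrix.one_apply, ite_smul, one_smul, zero_smul]

/-- A family of commuting systems of matrix units. -/
structure IsUnitsFamily (e : ι → Fin 3 → Fin 3 → A) : Prop where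
  units : ∀ n, IsUnits (e n)
  commute : ∀ n m, n ≠ m → ∀ i j k l, Commute (e n i j) (e m k l)

namespace IsUnitsFamily

variable (he : IsUnitsFamily e)
include he

lemma lax_lax {n m : ι} (h : n ≠ m) (x y : ℂ) :
    EntriesCommute (lax η (e n) x) (lax η (e m) y) := by
  intro i j k l
  simp only [lax, Matrix.of_apply]
  refine Commute.add_left ((Commute.one_left _).smul_left _) (Commute.smul_left ?_ _)
  exact Commute.add_right ((Commute.one_right _).smul_right _)
    ((he.commute n m h i j k l).smul_right _)

lemma laxProd_lax {n : ι} {l : List ι} (h : n ∉ l) (x y : ℂ) :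
    EntriesCommute (laxProd η ξ e l x) (lax η (e n) y) := by
  induction l with
  | nil => exact entriesCommute_one _
  | cons m l ih =>
    rw [List.mem_cons, not_or] at h
    intro i j k r
    rw [laxProd_cons, Matrix.mul_apply]
    exact Commute.sum_left _ _ _ fun p _ =>
      ((he.lax_lax (Ne.symm h.1) _ _) _ _ _ _).mul_left (ih h.2 _ _ _ _)

lemma exchange {l : List ι} (hl : l.Nodup) (x y : ℂ) :
    Exchange η (x - y) (laxProd η ξ e l x) (laxProd η ξ e l y) := by
  induction l with
  | nil =>
    rw [laxProd_nil, laxProd_nil, ← twist_one]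
    exact twist_exchange 1 _
  | cons n l ih =>
    rw [List.nodup_cons] at hl
    rw [laxProd_cons, laxProd_cons]
    refine Exchange.mul ?_ (ih hl.2) (he.laxProd_lax hl.1 _ _) (he.laxProd_lax hl.1 _ _)
    simpa using lax_exchange (η := η) (he.units n) (x - ξ n) (y - ξ n)

lemma exchange_shift {l : List ι} (hl : l.Nodup) (x : ℂ) :
    Exchange η η (laxProd η ξ e l x) (laxProd η ξ e l (x - η)) := by
  simpa using he.exchange (η := η) (ξ := ξ) hl x (x - η)

lemma hasQdet {l : List ι} (hl : l.Nodup) (x : ℂ) :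
    HasQdet (laxProd η ξ e l x) (laxProd η ξ e l (x - η)) (laxProd η ξ e l (x - 2 * η))
      (l.map fun n => (x - ξ n + η) * (x - ξ n - η) * (x - ξ n - 2 * η)).prod := by
  induction l with
  | nil =>
    simpa [laxProd_nil, twist_one] using twist_hasQdet (A := A) 1
  | cons n l ih =>
    rw [List.nodup_cons] at hl
    rw [laxProd_cons, laxProd_cons, laxProd_cons, List.map_cons, List.prod_cons]
    refine HasQdet.mul ?_ (ih hl.2) (he.laxProd_lax hl.1 _ _) (he.laxProd_lax hl.1 _ _)
      (he.laxProd_lax hl.1 _ _)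
    rw [sub_right_comm x η, sub_right_comm x (2 * η)]
    exact lax_hasQdet (he.units n) (x - ξ n)

lemma rowAntisymm (hη : η ≠ 0) {l : List ι} (hl : l.Nodup) {a : ι} (ha : a ∈ l) :
    RowAntisymm (laxProd η ξ e l (ξ a)) (laxProd η ξ e l (ξ a - η)) := by
  induction l with
  | nil => simp at ha
  | cons n l ih =>
    rw [List.nodup_cons] at hl
    rw [laxProd_cons, laxProd_cons]
    rcases eq_or_ne a n with rfl | han
    · refine RowAntisymm.mul ?_ (he.laxProd_lax hl.1 _ _)
      simpa using lax_rowAntisymm (η := η) (he.units a)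
    · refine Exchange.rowAntisymm_mul hη ?_
        (ih hl.2 ((List.mem_cons.mp ha).resolve_left han)) (he.laxProd_lax hl.1 _ _)
      simpa using lax_exchange (η := η) (he.units n) (ξ a - ξ n) (ξ a - η - ξ n)

omit he in
lemma hasScalarLead_laxProd (l : List ι) (i j : Fin 3) :
    HasScalarLead l.length (fun x => laxProd η ξ e l x i j) := by
  induction l generalizing i j with
  | nil =>
    simp only [laxProd_nil, Matrix.one_apply]
    split_ifs
    exacts [HasScalarLead.one, HasScalarLead.zero]
  | cons n l ih =>
    simp only [laxProd_cons, Matrix.mul_apply]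
    refine HasScalarLead.sum _ fun p _ => ?_
    have h : ∀ x, lax η (e n) (x - ξ n) i p =
        (delta i p * x) • (1 : A) + ((-(ξ n * delta i p)) • (1 : A) + η • e n i p) := fun x => by
      simp only [lax, Matrix.of_apply]
      module
    simp only [h]
    exact (ih p j).linear_mul _ _

lemma colWedge_laxProd (hη : η ≠ 0) {l : List ι} (hl : l.Nodup) :
    ∃ G : Fin 3 → Fin 3 → Fin 3 → Fin 3 → ℂ → A,
      (∀ i k j r, HasScalarLead l.length (G i k j r)) ∧ ∀ i k j r x,
      colWedge (laxProd η ξ e l x) (laxProd η ξ e l (x - η)) i k j r =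
        (l.map fun n => x - η - ξ n).prod • G i k j r x := by
  induction l with
  | nil =>
    refine ⟨fun i k j r _ => (delta i j * delta k r - delta i r * delta k j) • 1,
      fun i k j r => HasScalarLead.one.smul _, fun i k j r x => ?_⟩
    rw [laxProd_nil, laxProd_nil, ← twist_one]
    simp only [colWedge, twist, Matrix.of_apply, Matrix.one_apply, List.map_nil, List.prod_nil,
      delta, one_smul, smul_mul_smul_comm, mul_one, sub_smul]
  | cons n l ih =>
    rw [List.nodup_cons] at hl
    obtain ⟨G, hG, hGl⟩ := ih hl.2
    refine ⟨fun i k j r x => (2⁻¹ : ℂ) • ∑ p, ∑ s,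
      laxWedge η (e n) (x - ξ n) i k p s * G p s j r x, fun i k j r => ?_, fun i k j r x => ?_⟩
    · refine HasScalarLead.smul (HasScalarLead.sum _ fun p _ => HasScalarLead.sum _ fun s _ => ?_) _
      have h : ∀ x, laxWedge η (e n) (x - ξ n) i k p s =
          ((delta i p * delta k s - delta i s * delta k p) * x) • (1 : A) +
            laxWedge η (e n) (-ξ n) i k p s := fun x => by
        simp only [laxWedge]
        module
      simp only [h]
      exact (hG p s j r).linear_mul _ _
    · rw [laxProd_cons, laxProd_cons,
        Exchange.colWedge_mul hη (he.exchange_shift hl.2 x) (he.laxProd_lax hl.1 _ _)]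
      simp only [hGl, sub_right_comm x η, colWedge_lax (he.units n), smul_mul_smul_comm,
        ← Finset.smul_sum, List.map_cons, List.prod_cons]
      rw [smul_comm]

end IsUnitsFamily

end Chain

section Transfer

universe u

variable {A : Type u} [Ring A] [Algebra ℂ A] {N : ℕ} {η : ℂ} {ξ : Fin N → ℂ}
  {e : Fin N → Fin 3 → Fin 3 → A}

/-- The twisted ordered product of Lax matrices over all sites, as a matrix of operators. -/
def laxMonodromy (η : ℂ) (ξ : Fin N → ℂ) (e : Fin N → Fin 3 → Fin 3 → A)
    (K : Matrix (Fin 3) (Fin 3) ℂ) (x : ℂ) : Matrix (Fin 3) (Fin 3) A :=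
  twist K * laxProd η ξ e (List.finRange N).reverse x

/-- The trace of the monodromy matrix. -/
def transfer₁ (η : ℂ) (ξ : Fin N → ℂ) (e : Fin N → Fin 3 → Fin 3 → A)
    (K : Matrix (Fin 3) (Fin 3) ℂ) (x : ℂ) : A :=
  (laxMonodromy η ξ e K x).trace

/-- The fused trace of the monodromy matrix. -/
def transfer₂ (η : ℂ) (ξ : Fin N → ℂ) (e : Fin N → Fin 3 → Fin 3 → A)
    (K : Matrix (Fin 3) (Fin 3) ℂ) (x : ℂ) : A :=
  wedgeTrace (laxMonodromy η ξ e K x) (laxMonodromy η ξ e K (x - η))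

lemma nodup_finRange_reverse : (List.finRange N).reverse.Nodup :=
  List.nodup_reverse.mpr (List.nodup_finRange N)

lemma prod_map_finRange_reverse (f : Fin N → ℂ) :
    ((List.finRange N).reverse.map f).prod = ∏ n, f n := by
  rw [List.map_reverse, List.prod_reverse, ← List.ofFn_eq_map, List.prod_ofFn]

namespace IsUnitsFamily

variable (he : IsUnitsFamily e) (K : Matrix (Fin 3) (Fin 3) ℂ)
include he

lemma laxMonodromy_exchange (x y : ℂ) :
    Exchange η (x - y) (laxMonodromy η ξ e K x) (laxMonodromy η ξ e K y) :=
  (twist_exchange K _).mul (he.exchange nodup_finRange_reverse x y) (twist_commute _ _)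
    (twist_commute _ _)

lemma transfer₁_commute (x y : ℂ) : Commute (transfer₁ η ξ e K x) (transfer₁ η ξ e K y) := by
  rcases eq_or_ne x y with rfl | h
  · exact Commute.refl _
  · exact trace_commute h (he.laxMonodromy_exchange K x y) (he.laxMonodromy_exchange K y x)

lemma laxMonodromy_rowAntisymm (hη : η ≠ 0) (a : Fin N) :
    RowAntisymm (laxMonodromy η ξ e K (ξ a)) (laxMonodromy η ξ e K (ξ a - η)) :=
  (twist_exchange K η).rowAntisymm_mul hη
    (he.rowAntisymm hη nodup_finRange_reverse (by simp)) (twist_commute _ _)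

lemma laxMonodromy_hasQdet (x : ℂ) :
    HasQdet (laxMonodromy η ξ e K x) (laxMonodromy η ξ e K (x - η))
      (laxMonodromy η ξ e K (x - 2 * η)) (K.det * qdetI η ξ x) := by
  have h := he.hasQdet (η := η) (ξ := ξ) nodup_finRange_reverse x
  rw [prod_map_finRange_reverse] at h
  exact (twist_hasQdet K).mul h (twist_commute _ _) (twist_commute _ _) (twist_commute _ _)

lemma transfer₁_mul_transfer₁ (hη : η ≠ 0) (a : Fin N) :
    transfer₁ η ξ e K (ξ a) * transfer₁ η ξ e K (ξ a - η) = transfer₂ η ξ e K (ξ a) :=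
  (he.laxMonodromy_rowAntisymm K hη a).trace_mul_trace

lemma transfer₁_mul_transfer₂ (hη : η ≠ 0) (a : Fin N) :
    transfer₁ η ξ e K (ξ a) * transfer₂ η ξ e K (ξ a - η) =
      (K.det * qdetI η ξ (ξ a)) • (1 : A) := by
  refine (he.laxMonodromy_rowAntisymm K hη a).trace_mul_wedgeTrace hη ?_ ?_
  · simpa using he.laxMonodromy_exchange (η := η) (ξ := ξ) K (ξ a - η) (ξ a - η - η)
  · rw [show ξ a - η - η = ξ a - 2 * η by ring]
    exact he.laxMonodromy_hasQdet K (ξ a)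

omit he in
lemma hasScalarLead_transfer₁ : HasScalarLead N (transfer₁ η ξ e K) := by
  change HasScalarLead N fun x => ∑ i, laxMonodromy η ξ e K x i i
  simp only [laxMonodromy, Matrix.mul_apply, twist, Matrix.of_apply, smul_mul_assoc, one_mul]
  refine HasScalarLead.sum _ fun i _ => HasScalarLead.sum _ fun p _ => HasScalarLead.smul ?_ _
  simpa using hasScalarLead_laxProd (η := η) (ξ := ξ) (e := e) (List.finRange N).reverse p i

lemma exists_transfer₂_eq_smul (hη : η ≠ 0) :
    ∃ g : ℂ → A, HasScalarLead N g ∧ ∀ x, transfer₂ η ξ e K x = dfun ξ (x - η) • g x := by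
  obtain ⟨G, hG, hGl⟩ := he.colWedge_laxProd (ξ := ξ) hη (nodup_finRange_reverse (N := N))
  simp only [List.length_reverse, List.length_finRange] at hG
  refine ⟨fun x => (2⁻¹ : ℂ) • ∑ i, ∑ k, (2⁻¹ : ℂ) • ∑ p, ∑ r,
    (K i p * K k r - K i r * K k p) • G p r i k x, ?_, fun x => ?_⟩
  · exact HasScalarLead.smul (HasScalarLead.sum _ fun i _ => HasScalarLead.sum _ fun k _ =>
      HasScalarLead.smul (HasScalarLead.sum _ fun p _ => HasScalarLead.sum _ fun r _ =>
        (hG p r i k).smul _) _) _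
  · have h : ∀ i k p r, colWedge (twist K) (twist K) i k p r =
        (K i p * K k r - K i r * K k p) • (1 : A) := fun i k p r => by
      simp only [colWedge, twist, Matrix.of_apply, smul_mul_smul_comm, mul_one, sub_smul]
    simp only [transfer₂, wedgeTrace, laxMonodromy]
    simp only [Exchange.colWedge_mul hη (he.exchange_shift nodup_finRange_reverse x)
      (twist_commute _ _), h, hGl, prod_map_finRange_reverse, smul_mul_assoc, one_mul,
      smul_comm _ (∏ n, (x - η - ξ n)), ← Finset.smul_sum, dfun]

lemma transfer₂_mem (hη : η ≠ 0) (hξ : Function.Injective ξ) (hd : ∀ b, dfun ξ (ξ b - η) ≠ 0)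
    (x : ℂ) :
    transfer₂ η ξ e K x ∈ Algebra.adjoin ℂ (Set.range (transfer₁ η ξ e K)) := by
  obtain ⟨g, hg, hgl⟩ := he.exists_transfer₂_eq_smul (ξ := ξ) K hη
  obtain ⟨c, hc⟩ := hg.interpolate
  rw [hgl, hc ξ hξ]
  refine Subalgebra.smul_mem _ (add_mem (Subalgebra.smul_mem _ (one_mem _) _)
    (sum_mem fun b _ => Subalgebra.smul_mem _ ?_ _)) _
  have h : g (ξ b) = (dfun ξ (ξ b - η))⁻¹ •
      (transfer₁ η ξ e K (ξ b) * transfer₁ η ξ e K (ξ b - η)) := by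
    rw [he.transfer₁_mul_transfer₁ K hη, hgl, inv_smul_smul₀ (hd b)]
  rw [h]
  exact Subalgebra.smul_mem _ (mul_mem (Algebra.subset_adjoin (Set.mem_range_self _))
    (Algebra.subset_adjoin (Set.mem_range_self _))) _

open scoped IsMulCommutative in
/-- The transfer matrices form a fusion system in the commutative algebra they generate. -/
lemma exists_fusionSystem (hη : η ≠ 0) (hξ : Function.Injective ξ)
    (hd : ∀ b, dfun ξ (ξ b - η) ≠ 0) :
    ∃ (R : Type u) (_ : CommRing R) (_ : Algebra ℂ R) (incl : R →ₐ[ℂ] A) (t₁ t₂ : ℂ → R),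
      (∀ x, incl (t₁ x) = transfer₁ η ξ e K x) ∧ (∀ x, incl (t₂ x) = transfer₂ η ξ e K x) ∧
      FusionSystem η ξ (fun a => K.det * qdetI η ξ (ξ a)) t₁ t₂ := by
  have : IsMulCommutative (Algebra.adjoin ℂ (Set.range (transfer₁ η ξ e K))) :=
    Algebra.isMulCommutative_adjoin ℂ <| by
      rintro _ ⟨x, rfl⟩ _ ⟨y, rfl⟩
      exact he.transfer₁_commute K x y
  refine ⟨Algebra.adjoin ℂ (Set.range (transfer₁ η ξ e K)), inferInstance, inferInstance,
    Subalgebra.val _, fun x => ⟨_, Algebra.subset_adjoin (Set.mem_range_self x)⟩,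
    fun x => ⟨_, he.transfer₂_mem K hη hξ hd x⟩, fun _ => rfl, fun _ => rfl, ?_, ?_, ?_, ?_⟩
  · obtain ⟨c, hc⟩ := (hasScalarLead_transfer₁ (η := η) (ξ := ξ) (e := e) K).interpolate
    exact ⟨c, fun p hp x => Subtype.ext (by simpa using hc p hp x)⟩
  · obtain ⟨g, hg, hgl⟩ := he.exists_transfer₂_eq_smul (ξ := ξ) K hη
    obtain ⟨c, hc⟩ := hg.interpolate
    refine ⟨fun x p => dfun ξ (x - η) * c x p, fun p hp hdp x => Subtype.ext ?_⟩
    simp only [AddMemClass.coe_add, SetLike.val_smul, OneMemClass.coe_one,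
      AddSubmonoidClass.coe_finsetSum]
    simp only [hgl, smul_smul]
    rw [hc p hp x, smul_add, Finset.smul_sum, smul_smul]
    congr 1
    refine Finset.sum_congr rfl fun b _ => ?_
    rw [smul_smul]
    congr 1
    have := hdp b
    field_simp
  · exact fun a => Subtype.ext (he.transfer₁_mul_transfer₁ K hη a)
  · exact fun a => Subtype.ext (he.transfer₁_mul_transfer₂ K hη a)

end IsUnitsFamily

end Transfer
section Concrete

variable {N : ℕ}

/-- The matrix units acting on one site of the chain. -/
def siteUnit (n : Fin N) (i j : Fin 3) : Op N := Matrix.of fun f g =>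
  if i = g n ∧ f = Function.update g n j then 1 else 0

lemma mul_siteUnit (X : Op N) (n : Fin N) (i j : Fin 3) (f g : St N) :
    (X * siteUnit n i j) f g = if i = g n then X f (Function.update g n j) else 0 := by
  rw [Matrix.mul_apply]
  split_ifs with h
  · simp [siteUnit, h]
  · simp [siteUnit, h]

lemma siteUnit_isUnitsFamily : IsUnitsFamily (siteUnit (N := N)) where
  units n :=
    { mul := fun i j k l => by
        ext f g
        rw [mul_siteUnit, Matrix.smul_apply, smul_eq_mul]
        simp only [siteUnit, Matrix.of_apply, delta, Function.update_self, Function.update_idem]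
        split_ifs <;> simp_all
      trace := by
        ext f g
        simp only [Matrix.add_apply, siteUnit, Matrix.of_apply, Matrix.one_apply]
        have h : ∀ i : Fin 3, (i = g n ∧ f = Function.update g n i) ↔ (g n = i ∧ f = g) := by
          intro i
          constructor
          · rintro ⟨rfl, h⟩
            simpa using h
          · rintro ⟨rfl, h⟩
            simpa using h
        simp only [h]
        rcases fin3_cases (g n) with hg | hg | hg <;> simp [hg] }
  commute n m hnm i j k l := by
    ext f g
    rw [mul_siteUnit, mul_siteUnit]
    have h : Function.update (Function.update g m l) n j =
        Function.update (Function.update g n j) m l := Function.update_comm hnm.symm _ _ _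
    simp only [siteUnit, Matrix.of_apply, Function.update_of_ne hnm, Function.update_of_ne hnm.symm,
      h]
    split_ifs <;> simp_all

/-- The blocks of an operator on the auxiliary space tensored with the chain. -/
abbrev blocks (M : Matrix (Fin 3 × St N) (Fin 3 × St N) ℂ) : Matrix (Fin 3) (Fin 3) (Op N) :=
  (Matrix.compRingEquiv (Fin 3) (St N) ℂ).symm M

lemma blocks_apply (M : Matrix (Fin 3 × St N) (Fin 3 × St N) ℂ) (i j : Fin 3) (f g : St N) :
    blocks M i j f g = M (i, f) (j, g) := rfl

lemma blocks_Raux (η : ℂ) (ξ : Fin N → ℂ) (x : ℂ) (n : Fin N) :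
    blocks (Raux η ξ x n) = lax η (siteUnit n) (x - ξ n) := by
  ext i j f g
  simp only [blocks_apply, Raux, lax, siteUnit, delta, Matrix.of_apply, Matrix.add_apply,
    Matrix.smul_apply, Matrix.one_apply, Prod.mk.injEq, smul_eq_mul, ite_and]
  split_ifs <;> ring

lemma blocks_Kaux (K : Matrix (Fin 3) (Fin 3) ℂ) :
    blocks (Kaux K : Matrix (Fin 3 × St N) (Fin 3 × St N) ℂ) = twist K := by
  ext i j f g
  simp [blocks_apply, Kaux, twist, Matrix.one_apply]

lemma blocks_monodromy (η : ℂ) (ξ : Fin N → ℂ) (K : Matrix (Fin 3) (Fin 3) ℂ) (x : ℂ) :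
    blocks (monodromy η ξ K x) = laxMonodromy η ξ siteUnit K x := by
  rw [monodromy, blocks, map_mul, map_list_prod, List.map_reverse, List.map_ofFn, laxMonodromy,
    laxProd, List.map_reverse, ← List.ofFn_eq_map]
  have h : ((Matrix.compRingEquiv (Fin 3) (St N) ℂ).symm ∘ fun n => Raux η ξ x n) =
      fun n => lax η (siteUnit n) (x - ξ n) := funext fun n => blocks_Raux η ξ x n
  rw [h]
  exact congrArg (· * _) (blocks_Kaux K)

lemma T1_eq (η : ℂ) (ξ : Fin N → ℂ) (K : Matrix (Fin 3) (Fin 3) ℂ) (x : ℂ) :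
    T1 η ξ K x = transfer₁ η ξ siteUnit K x := by
  rw [transfer₁, ← blocks_monodromy]
  ext f g
  simp [T1, Matrix.trace, Matrix.sum_apply]

lemma antisym2_mul (X : Matrix ((Fin 3 × Fin 3) × St N) ((Fin 3 × Fin 3) × St N) ℂ)
    (i k : Fin 3) (f : St N) (q : (Fin 3 × Fin 3) × St N) :
    (antisym2 * X : Matrix ((Fin 3 × Fin 3) × St N) ((Fin 3 × Fin 3) × St N) ℂ) ((i, k), f) q =
      2⁻¹ * (X ((i, k), f) q - X ((k, i), f) q) := by
  have h : ∀ p, (antisym2 : Matrix ((Fin 3 × Fin 3) × St N) ((Fin 3 × Fin 3) × St N) ℂ)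
      ((i, k), f) p = 2⁻¹ * ((if p = ((i, k), f) then 1 else 0) -
        (if p = ((k, i), f) then 1 else 0)) := by
    rintro ⟨⟨a, b⟩, m⟩
    rw [antisym2, Matrix.of_apply]
    by_cases hm : m = f
    · subst hm
      simp only [if_true, one_mul, Prod.mk.injEq, and_true]
      congr 2
      · exact if_congr ⟨fun h => ⟨h.1.symm, h.2.symm⟩, fun h => ⟨h.1.symm, h.2.symm⟩⟩ rfl rfl
      · exact if_congr ⟨fun h => ⟨h.2.symm, h.1.symm⟩, fun h => ⟨h.2.symm, h.1.symm⟩⟩ rfl rfl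
    · simp [hm, Ne.symm hm]
  simp only [Matrix.mul_apply, h, mul_sub, sub_mul, Finset.sum_sub_distrib, mul_ite, mul_one,
    mul_zero, ite_mul, zero_mul, Finset.sum_ite_eq', Finset.mem_univ, if_true]

lemma emb1_mul_emb2 (M M' : Matrix (Fin 3 × St N) (Fin 3 × St N) ℂ) (i k j l : Fin 3)
    (f g : St N) :
    (emb1 M * emb2 M') ((i, k), f) ((j, l), g) = (blocks M i j * blocks M' k l) f g := by
  rw [Matrix.mul_apply, Matrix.mul_apply, Fintype.sum_prod_type, Finset.sum_comm]
  refine Finset.sum_congr rfl fun m _ => ?_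
  rw [Finset.sum_eq_single_of_mem (j, k) (Finset.mem_univ _)]
  · simp [emb1, emb2]
  · rintro ⟨a, b⟩ - hab
    simp only [emb1, emb2, Matrix.of_apply, mul_ite, mul_one, mul_zero]
    split_ifs <;> simp_all

lemma T2_eq (η : ℂ) (ξ : Fin N → ℂ) (K : Matrix (Fin 3) (Fin 3) ℂ) (x : ℂ) :
    T2 η ξ K x = transfer₂ η ξ siteUnit K x := by
  rw [transfer₂, ← blocks_monodromy, ← blocks_monodromy]
  ext f g
  rw [T2, Matrix.of_apply]
  generalize monodromy η ξ K x = M, monodromy η ξ K (x - η) = M'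
  simp only [mul_assoc, antisym2_mul, emb1_mul_emb2, Fintype.sum_prod_type,
    wedgeTrace, colWedge, Matrix.smul_apply, Matrix.sum_apply, Matrix.sub_apply, smul_eq_mul,
    Finset.mul_sum, mul_sub, Finset.sum_sub_distrib]
  congr 1
  exact Finset.sum_comm

end Concrete

section Coupling

variable {N : ℕ} {η : ℂ} {ξ : Fin N → ℂ}

lemma InhomCond.injective (hξ : InhomCond η ξ) : Function.Injective ξ := by
  intro a b hab
  by_contra hne
  exact (hξ a b hne).1 (sub_eq_zero.mpr hab)

lemma InhomCond.injective_sub (hξ : InhomCond η ξ) (s : Fin N → Prop) [DecidablePred s] :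
    Function.Injective fun b => ξ b - (if s b then 1 else 0 : ℂ) * η := by
  intro a b hab
  by_contra hne
  obtain ⟨h₁, h₂, h₃⟩ := hξ a b hne
  have h : ξ a - ξ b = (if s a then 1 else 0 : ℂ) * η - (if s b then 1 else 0 : ℂ) * η := by
    linear_combination hab
  split_ifs at h <;> simp_all

lemma InhomCond.injective_node₁ (hξ : InhomCond η ξ) (h : St N) :
    Function.Injective (node₁ η ξ h) :=
  hξ.injective_sub fun b => h b = 2

lemma InhomCond.injective_node₂ (hξ : InhomCond η ξ) (h : St N) :
    Function.Injective (node₂ η ξ h) := by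
  convert hξ.injective_sub fun b => h b ≠ 0 using 2 with b
  simp only [node₂, ne_eq, ite_not]

lemma InhomCond.dfun_ne_zero (hη : η ≠ 0) (hξ : InhomCond η ξ) (b : Fin N) :
    dfun ξ (ξ b - η) ≠ 0 := by
  refine Finset.prod_ne_zero_iff.mpr fun a _ => ?_
  rcases eq_or_ne b a with rfl | h
  · simpa using hη
  · rw [sub_right_comm]
    exact sub_ne_zero.mpr (hξ b a h).2.1

lemma prod_erase_eq_mul_prod_filter {i j : Fin N} (hij : i ≠ j) (f : Fin N → ℂ) :
    ∏ c ∈ Finset.univ.erase j, f c =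
      f i * ∏ m ∈ Finset.univ.filter (fun m => m ≠ i ∧ m ≠ j), f m := by
  rw [← Finset.mul_prod_erase _ _ (Finset.mem_erase.mpr ⟨hij, Finset.mem_univ i⟩)]
  congr 2
  ext m
  simp

lemma coupling_coefficient {i j : Fin N} (hij : i ≠ j) {l : St N} {h k : St N} (hi : h i = 1)
    (hj : h j = 2) (ki : k i = 0) (kj : k j = 1) (hl : ∀ m, m ≠ i → m ≠ j → h m = l m)
    (kl : ∀ m, m ≠ i → m ≠ j → k m = l m) :
    lagr (node₁ η ξ h) j (ξ i - η) * lagr (node₂ η ξ k) i (ξ j) =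
      η ^ 2 / (ξ i - ξ j + η) ^ 2 * ∏ m ∈ Finset.univ.filter (fun m => m ≠ i ∧ m ≠ j),
        ((ξ i - η - (ξ m - (if l m = 2 then 1 else 0 : ℂ) * η)) *
            (ξ j - (ξ m - (if l m = 0 then 0 else 1 : ℂ) * η))) /
          ((ξ j - η - (ξ m - (if l m = 2 then 1 else 0 : ℂ) * η)) *
            (ξ i - (ξ m - (if l m = 0 then 0 else 1 : ℂ) * η))) := by
  simp only [mul_div_mul_comm, Finset.prod_mul_distrib]
  rw [lagr, lagr, prod_erase_eq_mul_prod_filter hij, prod_erase_eq_mul_prod_filter hij.symm]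
  have e₁ : (ξ i - η - node₁ η ξ h i) / (node₁ η ξ h j - node₁ η ξ h i) =
      η / (ξ i - ξ j + η) := by
    rw [← neg_div_neg_eq]
    simp only [node₁, hi, hj, show (1 : Fin 3) ≠ 2 by decide, if_false, if_true]
    congr 1 <;> ring
  have e₂ : (ξ j - node₂ η ξ k j) / (node₂ η ξ k i - node₂ η ξ k j) = η / (ξ i - ξ j + η) := by
    simp only [node₂, ki, kj, show (1 : Fin 3) ≠ 0 by decide, if_false, if_true]
    congr 1 <;> ring
  have e₃ : ∏ m ∈ Finset.univ.filter (fun m => m ≠ i ∧ m ≠ j),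
      (ξ i - η - node₁ η ξ h m) / (node₁ η ξ h j - node₁ η ξ h m) =
      ∏ m ∈ Finset.univ.filter (fun m => m ≠ i ∧ m ≠ j),
        (ξ i - η - (ξ m - (if l m = 2 then 1 else 0 : ℂ) * η)) /
          (ξ j - η - (ξ m - (if l m = 2 then 1 else 0 : ℂ) * η)) := by
    refine Finset.prod_congr rfl fun m hm => ?_
    obtain ⟨-, hmi, hmj⟩ := Finset.mem_filter.mp hm
    simp only [node₁, hj, hl m hmi hmj, if_true, one_mul]
  have e₄ : ∏ m ∈ Finset.univ.filter (fun m => m ≠ j ∧ m ≠ i),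
      (ξ j - node₂ η ξ k m) / (node₂ η ξ k i - node₂ η ξ k m) =
      ∏ m ∈ Finset.univ.filter (fun m => m ≠ i ∧ m ≠ j),
        (ξ j - (ξ m - (if l m = 0 then 0 else 1 : ℂ) * η)) /
          (ξ i - (ξ m - (if l m = 0 then 0 else 1 : ℂ) * η)) := by
    refine Finset.prod_congr (Finset.filter_congr fun _ _ => and_comm) fun m hm => ?_
    obtain ⟨-, hmi, hmj⟩ := Finset.mem_filter.mp hm
    simp only [node₂, ki, kl m hmi hmj, if_true, zero_mul, sub_zero]
  rw [e₁, e₂, e₃, e₄, mul_mul_mul_comm, ← sq, div_pow]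

/-- The pairing `⟨L| X |R0⟩` as a linear functional of the operator `X`. -/
def expectation (L R0 : Hsp N) : Op N →ₗ[ℂ] ℂ where
  toFun X := pair (Matrix.vecMul L X) R0
  map_add' X Y := by
    rw [Matrix.vecMul_add]
    exact add_dotProduct _ _ _
  map_smul' c X := by
    rw [Matrix.vecMul_smul]
    exact smul_dotProduct _ _ _

lemma pair_sov_eq (K : Matrix (Fin 3) (Fin 3) ℂ) (L R0 : Hsp N) (h k : St N) :
    pair (sovCov η ξ K L h) (sovVec η ξ K R0 k) =
      expectation L R0 (sovCovOp η ξ K h * sovVecOp η ξ K k) := by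
  change Matrix.vecMul L (sovCovOp η ξ K h) ⬝ᵥ Matrix.mulVec (sovVecOp η ξ K k) R0 =
    Matrix.vecMul L (sovCovOp η ξ K h * sovVecOp η ξ K k) ⬝ᵥ R0
  rw [Matrix.dotProduct_mulVec, Matrix.vecMul_vecMul]

section Lift

variable {R : Type*} [CommRing R] [Algebra ℂ R] {K : Matrix (Fin 3) (Fin 3) ℂ}
  (incl : R →ₐ[ℂ] Op N) {t₁ t₂ : ℂ → R}

lemma map_covProd (h₁ : ∀ x, incl (t₁ x) = T1 η ξ K x) (h₂ : ∀ x, incl (t₂ x) = T2 η ξ K x)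
    (h : St N) : incl (covProd η ξ t₁ t₂ h) = sovCovOp η ξ K h := by
  rw [covProd, ← List.prod_ofFn, map_list_prod, List.map_ofFn, sovCovOp]
  congr 2
  funext n
  simp only [Function.comp_apply, covFactor, map_mul, map_pow, h₁, h₂]

lemma map_vecProd (h₁ : ∀ x, incl (t₁ x) = T1 η ξ K x) (h₂ : ∀ x, incl (t₂ x) = T2 η ξ K x)
    (h : St N) : incl (vecProd ξ t₁ t₂ h) = sovVecOp η ξ K h := by
  rw [vecProd, ← List.prod_ofFn, map_list_prod, List.map_ofFn, sovVecOp]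
  congr 2
  funext n
  simp only [Function.comp_apply, vecFactor, map_mul, map_pow, h₁, h₂]

end Lift

lemma DualRef.T2_ne_zero {K : Matrix (Fin 3) (Fin 3) ℂ} {L R0 : Hsp N}
    (hR0 : DualRef η ξ K L R0) (b : Fin N) : T2 η ξ K (ξ b - η) ≠ 0 := by
  intro hb
  have h0 : sovCovOp η ξ K zeroSt = 0 := by
    refine List.prod_eq_zero (List.mem_ofFn.mpr ⟨b, ?_⟩)
    simp [zeroSt, hb]
  have h := hR0 zeroSt
  rw [sovCov, h0, Matrix.vecMul_zero, if_pos rfl] at h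
  exact zero_ne_one (Eq.trans (by simp [pair]) h)

lemma DualRef.dfun_ne_zero {K : Matrix (Fin 3) (Fin 3) ℂ} {L R0 : Hsp N} (hη : η ≠ 0)
    (hR0 : DualRef η ξ K L R0) (b : Fin N) : dfun ξ (ξ b - η - η) ≠ 0 := by
  intro hb
  obtain ⟨g, -, hg⟩ := siteUnit_isUnitsFamily.exists_transfer₂_eq_smul (ξ := ξ) K hη
  refine hR0.T2_ne_zero b ?_
  rw [T2_eq, hg, hb, zero_smul]

/-- The coupling of SoV labels which differ by the exchange of a pair `(0,2)` with `(1,1)`. -/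
lemma sov_coupling_exchange {K : Matrix (Fin 3) (Fin 3) ℂ} {L R0 : Hsp N} (hη : η ≠ 0)
    (hξ : InhomCond η ξ) (hR0 : DualRef η ξ K L R0) {i j : Fin N} (hij : i ≠ j) (l : St N) :
    pair (sovCov η ξ K L fun m => if m = i then 0 else if m = j then 2 else l m)
        (sovVec η ξ K R0 fun m => if m = i then 1 else if m = j then 1 else l m) =
      K.det *
        (dfun ξ (ξ j - η) / dfun ξ (ξ i - η) * qdetI η ξ (ξ i) * η ^ 2 / (ξ i - ξ j + η) ^ 2 *
          ∏ m ∈ Finset.univ.filter (fun m => m ≠ i ∧ m ≠ j),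
            ((ξ i - η - (ξ m - (if l m = 2 then 1 else 0 : ℂ) * η)) *
                (ξ j - (ξ m - (if l m = 0 then 0 else 1 : ℂ) * η))) /
              ((ξ j - η - (ξ m - (if l m = 2 then 1 else 0 : ℂ) * η)) *
                (ξ i - (ξ m - (if l m = 0 then 0 else 1 : ℂ) * η)))) *
        pair (sovCov η ξ K L fun m => if m = i then 1 else if m = j then 1 else l m)
          (sovVec η ξ K R0 fun m => if m = i then 1 else if m = j then 1 else l m) := by
  set h : St N := fun m => if m = i then 0 else if m = j then 2 else l m
  set k : St N := fun m => if m = i then 1 else if m = j then 1 else l m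
  obtain ⟨R, _, _, incl, t₁, t₂, ht₁, ht₂, S⟩ :=
    siteUnit_isUnitsFamily.exists_fusionSystem K hη hξ.injective (hξ.dfun_ne_zero hη)
  replace ht₁ : ∀ x, incl (t₁ x) = T1 η ξ K x := fun x => by rw [ht₁, T1_eq]
  replace ht₂ : ∀ x, incl (t₂ x) = T2 η ξ K x := fun x => by rw [ht₂, T2_eq]
  have hd : ∀ h b, dfun ξ (node₂ η ξ h b - η) ≠ 0 := fun h b => by
    rw [node₂]
    split_ifs
    · simpa using hξ.dfun_ne_zero hη b
    · simpa using hR0.dfun_ne_zero hη b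
  have hφ : ∀ h, h ≠ 0 → (expectation L R0 ∘ₗ incl.toLinearMap) (covProd η ξ t₁ t₂ h) = 0 :=
    fun h hh => by
      rw [LinearMap.comp_apply, AlgHom.toLinearMap_apply, map_covProd incl ht₁ ht₂]
      exact (hR0 h).trans (if_neg hh)
  have hk : k = Function.update (Function.update h i 1) j 1 := by
    funext m
    simp only [k, h, Function.update_apply]
    split_ifs <;> rfl
  have key := S.coupling_exchange hξ.injective_node₁ hξ.injective_node₂ hd _ hφ hij
    (h := h) (by simp [h]) (by simp [h, hij.symm]) hk
  simp only [LinearMap.comp_apply, AlgHom.toLinearMap_apply, map_mul,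
    map_covProd incl ht₁ ht₂, map_vecProd incl ht₁ ht₂, ← pair_sov_eq] at key
  have hc := coupling_coefficient (η := η) (ξ := ξ) hij (l := l) (h := Function.update h i 1)
    (k := Function.update k i 0) (by simp) (by simp [h, hij.symm]) (by simp)
    (by simp [k, hij.symm]) (fun m hm hm' => by simp [h, hm, hm'])
    (fun m hm hm' => by simp [k, hm, hm'])
  rw [key]
  congr 1
  rw [mul_div_assoc, mul_assoc (_ / _ * _), ← hc]
  ring

end Coupling

end
end SoV

namespace SoV
noncomputable section

/-- explicit off-diagonal SoV coupling for a single `(1,1)` pair.  With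
`h = (0,2,h₃,…,h_N)` and `k = (1,1,h₃,…,h_N)` one has `⟨h|k⟩ = det K · C · ⟨k|k⟩` with the
explicit coefficient `C`. -/
theorem statement_19 (N : ℕ) (hN : 2 ≤ N) (η : ℂ) (hη : η ≠ 0)
    (ξ : Fin N → ℂ) (hξ : InhomCond η ξ)
    (K : Matrix (Fin 3) (Fin 3) ℂ) (hK : SimpleSpectrum K) (L R0 : Hsp N)
    (hbL : IsBasisFamily (sovCov η ξ K L))
    (hR0 : DualRef η ξ K L R0)
    (hbR : IsBasisFamily (sovVec η ξ K R0))
    (hrest : St N) :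
    letI i0 : Fin N := ⟨0, by omega⟩
    letI i1 : Fin N := ⟨1, by omega⟩
    letI h : St N := fun m => if m = i0 then 0 else if m = i1 then 2 else hrest m
    letI k : St N := fun m => if m = i0 then 1 else if m = i1 then 1 else hrest m
    pair (sovCov η ξ K L h) (sovVec η ξ K R0 k) =
      K.det *
        (dfun ξ (ξ i1 - η) / dfun ξ (ξ i0 - η) * qdetI η ξ (ξ i0) * η ^ 2 /
            (ξ i0 - ξ i1 + η) ^ 2 *
          ∏ m ∈ Finset.univ.filter (fun m => m ≠ i0 ∧ m ≠ i1),
            ((ξ i0 - η - (ξ m - (if hrest m = 2 then 1 else 0 : ℂ) * η)) *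
                (ξ i1 - (ξ m - (if hrest m = 0 then 0 else 1 : ℂ) * η))) /
              ((ξ i1 - η - (ξ m - (if hrest m = 2 then 1 else 0 : ℂ) * η)) *
                (ξ i0 - (ξ m - (if hrest m = 0 then 0 else 1 : ℂ) * η)))) *
        pair (sovCov η ξ K L k) (sovVec η ξ K R0 k) := by
  exact sov_coupling_exchange hη hξ hR0 (by simp) hrest

end
end SoV
end
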